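/- arXiv:math/0601397 — 2 statements merged into one kernel-verified Lean document; each statement's English description precedes it below -/
import Mathlib

section
/- Let f ∈ ℚ[x] be an irreducible polynomial of prime degree p ≥ 5, and suppose f has exactly r = 2s non-real complex roots with s ≥ 1. If s·(s·log s + 2·log s + 3) ≤ p, where log denotes the natural logarithm, then the Galois group of f over ℚ is isomorphic to the alternating group A_p or to the symmetric group S_p. -/
open Polynomial

open Equiv Equiv.Perm Finset

lemma card_offDiag_filter_mapsTo {α : Type*} [DecidableEq α] (Δ : Finset α)
    (g : Perm α) :
    #{q ∈ Δ.offDiag | g q.1 ∈ Δ ∧ g q.2 ∈ Δ} =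
      #{a ∈ Δ | g a ∈ Δ} * #{a ∈ Δ | g a ∈ Δ} - #{a ∈ Δ | g a ∈ Δ} := by
  rw [← offDiag_card]
  congr 1
  ext q
  simp only [mem_filter, mem_offDiag]
  tauto

section TwoTransitive

variable {α : Type*} [Fintype α] [DecidableEq α]

/-- The support of a commutator has at most three times as many points as the intersection of the
supports. -/
lemma card_support_commutator_le (x y : Perm α) :
    #(x * y * x⁻¹ * y⁻¹).support ≤ 3 * #(x.support ∩ y.support) := by
  set I := x.support ∩ y.support with hI
  have hsub : (x * y * x⁻¹ * y⁻¹).support ⊆ I ∪ (I.image x ∪ I.image y) := by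
    intro a ha
    by_contra hcon
    simp only [mem_union, not_or, mem_image, not_exists, not_and] at hcon
    obtain ⟨h1, h2, h3⟩ := hcon
    have h2' : x⁻¹ a ∉ I := fun h => h2 _ h (by simp)
    have h3' : y⁻¹ a ∉ I := fun h => h3 _ h (by simp)
    simp only [hI, mem_inter, mem_support, not_and, not_not] at h1 h2' h3'
    have hxx : x (x⁻¹ a) = a := x.apply_symm_apply a
    have hyy : y (y⁻¹ a) = a := y.apply_symm_apply a
    rw [hxx] at h2'
    rw [hyy] at h3'
    rw [mem_support] at ha
    apply ha
    simp only [mul_apply]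
    by_cases hy : y a = a
    · have hy' : y⁻¹ a = a := by rw [inv_eq_iff_eq, hy]
      rw [hy']
      by_cases hx : a = x⁻¹ a
      · rw [← hx, hy]
        conv_lhs => rw [hx]
        exact hxx
      · rw [h2' hx, hxx]
    · have hx : x a = a := by
        by_contra hx; exact hy (h1 hx)
      have hya : a ≠ y⁻¹ a := fun h => hy (by rw [eq_comm, inv_eq_iff_eq] at h; exact h.symm)
      have : x (y⁻¹ a) = y⁻¹ a := by
        by_contra h
        exact hya (h3' h)
      have h' : x⁻¹ (y⁻¹ a) = y⁻¹ a := by rw [inv_eq_iff_eq, this]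
      rw [h', hyy, hx]
  calc _ ≤ _ := card_le_card hsub
    _ ≤ #I + (#(I.image x) + #(I.image y)) :=
      (card_union_le _ _).trans (Nat.add_le_add_left (card_union_le _ _) _)
    _ ≤ #I + (#I + #I) :=
      Nat.add_le_add_left (Nat.add_le_add card_image_le card_image_le) _
    _ = 3 * #I := by ring

/-- A permutation moving at most three points, other than the identity, is a transposition or a
three-cycle. -/
lemma isSwap_or_isThreeCycle_of_card_support_le {z : Perm α} (hz : z ≠ 1)
    (h : #z.support ≤ 3) : z.IsSwap ∨ z.IsThreeCycle := by
  have h1 := two_le_card_support_of_ne_one hz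
  obtain h2 | h3 : #z.support = 2 ∨ #z.support = 3 := by omega
  · exact .inl (card_support_eq_two.1 h2)
  · exact .inr (card_support_eq_three_iff.1 h3)

open Classical in
/-- In a `2`-transitive group of degree `n`, with `M` elements taking a given ordered pair of
distinct points to another one, there are `(n - 1) * M` elements taking a given point to a given
point. -/
lemma exists_card_filter_of_two_transitive [Nontrivial α] {G : Subgroup (Perm α)}
    (h2 : ∀ a b c d : α, a ≠ b → c ≠ d → ∃ g ∈ G, g a = c ∧ g b = d) :
    ∃ M : ℕ, 0 < M ∧
      (∀ a c : α, #{g : Perm α | g ∈ G ∧ g a = c} = (Fintype.card α - 1) * M) ∧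
      ∀ a b c d : α, a ≠ b → c ≠ d → #{g : Perm α | g ∈ G ∧ g a = c ∧ g b = d} = M := by
  obtain ⟨a₀, b₀, h₀⟩ := exists_pair_ne α
  have key : ∀ a b c d : α, a ≠ b → c ≠ d → #{g : Perm α | g ∈ G ∧ g a = c ∧ g b = d} =
      #{g : Perm α | g ∈ G ∧ g a₀ = a₀ ∧ g b₀ = b₀} := by
    intro a b c d hab hcd
    obtain ⟨u, hu, hua, hub⟩ := h2 a₀ b₀ a b h₀ hab
    obtain ⟨v, hv, hva, hvb⟩ := h2 c d a₀ b₀ hcd h₀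
    refine card_equiv ((Equiv.mulRight u).trans (Equiv.mulLeft v)) fun g => ?_
    have e1 : g a = c ↔ v (g a) = a₀ := by rw [← hva]; simp
    have e2 : g b = d ↔ v (g b) = b₀ := by rw [← hvb]; simp
    have e3 : v * (g * u) ∈ G ↔ g ∈ G := by
      rw [G.mul_mem_cancel_left hv, G.mul_mem_cancel_right hu]
    simp [hua, hub, e1, e2, e3]
  refine ⟨#{g : Perm α | g ∈ G ∧ g a₀ = a₀ ∧ g b₀ = b₀},
    card_pos.2 ⟨1, by simp [G.one_mem]⟩, fun a c => ?_, key⟩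
  obtain ⟨b, hb⟩ := exists_ne a
  rw [card_eq_sum_card_fiberwise (f := fun g : Perm α => g b) (t := univ.erase c)]
  · rw [← card_univ, ← card_erase_of_mem (mem_univ c), ← smul_eq_mul, ← sum_const]
    refine sum_congr rfl fun d hd => ?_
    rw [← key a b c d hb.symm (ne_of_mem_erase hd).symm, filter_filter]
    simp only [and_assoc]
  · intro g hg
    have hg' : g a = c := by simpa using (mem_filter.1 hg).2.2
    simp only [coe_erase, coe_univ, Set.mem_sdiff, Set.mem_univ, Set.mem_singleton_iff, true_and]
    rw [← hg']
    exact fun h => hb (g.injective h)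

open Classical in
/-- Double counting of the pairs `(g, a)` with `a` and `g a` in `Δ`. -/
lemma sum_card_filter_mapsTo {G : Subgroup (Perm α)} {N : ℕ}
    (hN : ∀ a c : α, #{g : Perm α | g ∈ G ∧ g a = c} = N) (Δ : Finset α) :
    ∑ g with g ∈ G, #{a ∈ Δ | g a ∈ Δ} = #Δ * #Δ * N := by
  have : ∀ g : Perm α, #{a ∈ Δ | g a ∈ Δ} = ∑ q ∈ Δ ×ˢ Δ, if g q.1 = q.2 then 1 else 0 := by
    intro g
    rw [sum_product, card_filter]
    simp
  simp_rw [this]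
  rw [sum_comm, ← card_product, ← smul_eq_mul, ← sum_const]
  refine sum_congr rfl fun q _ => ?_
  rw [← hN q.1 q.2, ← card_filter, filter_filter]

open Classical in
/-- Double counting of the pairs `(g, q)` with `q ∈ S` mapped by `g` into `Δ × Δ`. -/
lemma sum_card_filter_pair_mapsTo {G : Subgroup (Perm α)} {M : ℕ}
    (hM : ∀ a b c d : α, a ≠ b → c ≠ d → #{g : Perm α | g ∈ G ∧ g a = c ∧ g b = d} = M)
    (Δ : Finset α) (S : Finset (α × α)) (hS : ∀ q ∈ S, q.1 ≠ q.2) :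
    ∑ g with g ∈ G, #{q ∈ S | g q.1 ∈ Δ ∧ g q.2 ∈ Δ} = #S * #Δ.offDiag * M := by
  have : ∀ g : Perm α, #{q ∈ S | g q.1 ∈ Δ ∧ g q.2 ∈ Δ} =
      ∑ q ∈ S ×ˢ Δ.offDiag, if g q.1.1 = q.2.1 ∧ g q.1.2 = q.2.2 then 1 else 0 := by
    intro g
    rw [sum_product, card_filter]
    refine sum_congr rfl fun q hq => ?_
    rw [← card_filter]
    have hne : g q.1 ≠ g q.2 := fun h => hS q hq (g.injective h)
    split_ifs with h
    · symm
      rw [card_eq_one]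
      refine ⟨(g q.1, g q.2), ?_⟩
      ext r
      simp only [mem_filter, mem_offDiag, mem_singleton, Prod.ext_iff]
      grind
    · symm
      rw [card_eq_zero, filter_eq_empty_iff]
      intro r hr
      rw [mem_offDiag] at hr
      grind
  simp_rw [this]
  rw [sum_comm, ← card_product, ← smul_eq_mul, ← sum_const]
  refine sum_congr rfl fun q hq => ?_
  rw [mem_product, mem_offDiag] at hq
  rw [← hM q.1.1 q.1.2 q.2.1 q.2.2 (hS _ hq.1) hq.2.2.2, ← card_filter, filter_filter]

/-- If `g a` is moved by `t`, but `g (t a)` is not, then `t` does not commute with its conjugate by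
`g`, and their commutator has small support. -/
lemma exists_commutator_mem {G : Subgroup (Perm α)} {t g : Perm α} (ht : t ∈ G) (hg : g ∈ G)
    {a : α} (hga : g a ∈ t.support) (hgta : g (t a) ∉ t.support) :
    ∃ z ∈ G, z ≠ 1 ∧ #z.support ≤ 3 * #{b ∈ t.support | g b ∈ t.support} := by
  have hy : g⁻¹ * t * g ∈ G := G.mul_mem (G.mul_mem (G.inv_mem hg) ht) hg
  refine ⟨t * (g⁻¹ * t * g) * t⁻¹ * (g⁻¹ * t * g)⁻¹,
    G.mul_mem (G.mul_mem (G.mul_mem ht hy) (G.inv_mem ht)) (G.inv_mem hy), fun h => ?_, ?_⟩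
  · rw [mul_inv_eq_one, mul_inv_eq_iff_eq_mul] at h
    have h' := congrArg (fun σ : Perm α => g (σ a)) h
    have hgg : ∀ b, g (g⁻¹ b) = b := g.apply_symm_apply
    rw [notMem_support] at hgta
    rw [mem_support] at hga
    simp only [mul_apply, hgg, hgta] at h'
    exact hga (by rw [← hgg (t (g a)), t.injective (g.injective h')])
  · refine (card_support_commutator_le _ _).trans (Nat.mul_le_mul_left _ (card_le_card ?_))
    intro b
    simp only [mem_inter, mem_filter, mem_support, mul_apply, ne_eq, inv_eq_iff_eq]
    exact fun h => ⟨h.1, h.2⟩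

/-- A `2`-transitive group of degree `n` with a nonidentity element moving `m` points,
where `(m - 1) ^ 2 < n - 1`, contains the alternating group. -/
lemma alternatingGroup_le_of_card_support_sq_lt {G : Subgroup (Perm α)}
    (h2 : ∀ a b c d : α, a ≠ b → c ≠ d → ∃ g ∈ G, g a = c ∧ g b = d)
    {t : Perm α} (ht : t ∈ G) (ht1 : t ≠ 1)
    (hm : (#t.support - 1) ^ 2 < Fintype.card α - 1) : alternatingGroup α ≤ G := by
  classical
  have : Nontrivial α := Fintype.one_lt_card_iff_nontrivial.1 (by omega)
  have hprim : MulAction.IsPreprimitive G α := by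
    apply MulAction.isPreprimitive_of_is_two_pretransitive
    rw [MulAction.is_two_pretransitive_iff]
    intro a b c d hab hcd
    obtain ⟨g, hg, h⟩ := h2 a b c d hab hcd
    exact ⟨⟨g, hg⟩, h⟩
  obtain ⟨M, hM0, hN, hM⟩ := exists_card_filter_of_two_transitive h2
  set Δ := t.support with hΔ
  have hΔ0 : 2 ≤ #Δ := two_le_card_support_of_ne_one ht1
  obtain ⟨g, hg, hg1⟩ : ∃ g ∈ G, #{a ∈ Δ | g a ∈ Δ} = 1 := by
    by_contra! hcon
    have hle : ∑ g with g ∈ G, #{a ∈ Δ | g a ∈ Δ} ≤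
        ∑ g with g ∈ G, #{q ∈ Δ.offDiag | g q.1 ∈ Δ ∧ g q.2 ∈ Δ} := by
      refine sum_le_sum fun g hg => ?_
      have hX := hcon g (mem_filter.1 hg).2
      rw [card_offDiag_filter_mapsTo]
      generalize #{a ∈ Δ | g a ∈ Δ} = X at hX ⊢
      rcases X with _ | _ | X
      · simp
      · simp at hX
      · apply Nat.le_sub_of_add_le
        nlinarith
    rw [sum_card_filter_mapsTo hN, sum_card_filter_pair_mapsTo hM _ _
      (fun q hq => (mem_offDiag.1 hq).2.2), offDiag_card] at hle
    obtain ⟨m, hm'⟩ : ∃ m, #Δ = m + 1 := ⟨#Δ - 1, by omega⟩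
    have e : (m + 1) * (m + 1) - (m + 1) = (m + 1) * m := by
      rw [Nat.mul_succ]; simp
    rw [hm', Nat.add_sub_cancel] at hm
    rw [hm', e] at hle
    have : (m + 1) ^ 2 * M * (Fintype.card α - 1) ≤ (m + 1) ^ 2 * M * m ^ 2 := by nlinarith
    have := Nat.le_of_mul_le_mul_left this (by positivity)
    omega
  obtain ⟨a, ha⟩ := card_eq_one.1 hg1
  have haΔ : a ∈ Δ ∧ g a ∈ Δ := by
    have : a ∈ ({a ∈ Δ | g a ∈ Δ} : Finset α) := by rw [ha]; simp
    simpa using this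
  have hta : g (t a) ∉ Δ := by
    intro h
    have hmem : t a ∈ ({a ∈ Δ | g a ∈ Δ} : Finset α) := by
      rw [mem_filter]
      exact ⟨by rw [hΔ, apply_mem_support]; exact haΔ.1, h⟩
    rw [ha, mem_singleton] at hmem
    exact mem_support.1 haΔ.1 hmem
  obtain ⟨z, hzG, hz1, hz⟩ := exists_commutator_mem ht hg haΔ.2 hta
  rw [← hΔ, hg1] at hz
  rcases isSwap_or_isThreeCycle_of_card_support_le hz1 hz with h | h
  · rw [subgroup_eq_top_of_isPreprimitive_of_isSwap_mem hprim z h hzG]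
    exact le_top
  · exact alternatingGroup_le_of_isPreprimitive_of_isThreeCycle_mem hprim h hzG

/-- A `2`-transitive group of degree `n > 26` with a nonidentity element moving `m` points,
where `m * (m - 1) < 2 * (n - 1)`, contains the alternating group. -/
lemma alternatingGroup_le_of_card_support_mul_lt {G : Subgroup (Perm α)}
    (h2 : ∀ a b c d : α, a ≠ b → c ≠ d → ∃ g ∈ G, g a = c ∧ g b = d)
    {t : Perm α} (ht : t ∈ G) (ht1 : t ≠ 1) (hn : 26 < Fintype.card α)
    (hm : #t.support * (#t.support - 1) < 2 * (Fintype.card α - 1)) :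
    alternatingGroup α ≤ G := by
  classical
  have : Nontrivial α := Fintype.one_lt_card_iff_nontrivial.1 (by omega)
  obtain ⟨M, hM0, hN, hM⟩ := exists_card_filter_of_two_transitive h2
  set Δ := t.support with hΔ
  have hΔ0 : 2 ≤ #Δ := two_le_card_support_of_ne_one ht1
  obtain ⟨g, hg, a, ha, hga, hgta, hg2⟩ : ∃ g ∈ G, ∃ a ∈ Δ, g a ∈ Δ ∧ g (t a) ∉ Δ ∧
      #{a ∈ Δ | g a ∈ Δ} ≤ 2 := by
    by_contra! hcon
    set S : Finset (α × α) := Δ.image fun a => (a, t a) with hS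
    have hSne : ∀ q ∈ S, q.1 ≠ q.2 := by
      intro q hq
      obtain ⟨a, ha, rfl⟩ := mem_image.1 hq
      exact (mem_support.1 ha).symm
    have hScard : #S = #Δ := card_image_of_injective _ fun a b h => (Prod.ext_iff.1 h).1
    have hle : ∑ g with g ∈ G, 2 * #{a ∈ Δ | g a ∈ Δ} ≤
        ∑ g with g ∈ G, (#{q ∈ Δ.offDiag | g q.1 ∈ Δ ∧ g q.2 ∈ Δ} +
          #{q ∈ S | g q.1 ∈ Δ ∧ g q.2 ∈ Δ}) := by
      refine sum_le_sum fun g hg => ?_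
      have hg' := (mem_filter.1 hg).2
      rw [card_offDiag_filter_mapsTo]
      have hD : #{q ∈ S | g q.1 ∈ Δ ∧ g q.2 ∈ Δ} = #{a ∈ Δ | g a ∈ Δ ∧ g (t a) ∈ Δ} := by
        rw [hS, filter_image]
        exact card_image_of_injective _ fun a b h => (Prod.ext_iff.1 h).1
      rw [hD]
      by_cases hK : ∃ a ∈ Δ, g a ∈ Δ ∧ g (t a) ∉ Δ
      · obtain ⟨a, ha, hga, hgta⟩ := hK
        have hX := hcon g hg' a ha hga hgta
        generalize #{a ∈ Δ | g a ∈ Δ} = X at hX ⊢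
        refine le_trans ?_ (Nat.le_add_right _ _)
        apply Nat.le_sub_of_add_le
        nlinarith
      · push Not at hK
        have hfil : ({a ∈ Δ | g a ∈ Δ ∧ g (t a) ∈ Δ} : Finset α) = {a ∈ Δ | g a ∈ Δ} :=
          filter_congr fun a ha => ⟨fun h => h.1, fun h => ⟨h, hK a ha h⟩⟩
        rw [hfil]
        have hX : #{a ∈ Δ | g a ∈ Δ} ≠ 1 := by
          intro h1
          obtain ⟨a, ha⟩ := card_eq_one.1 h1
          have haΔ : a ∈ Δ ∧ g a ∈ Δ := by
            have : a ∈ ({a ∈ Δ | g a ∈ Δ} : Finset α) := by rw [ha]; simp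
            simpa using this
          have hmem : t a ∈ ({a ∈ Δ | g a ∈ Δ} : Finset α) := by
            rw [mem_filter]
            exact ⟨by rw [hΔ, apply_mem_support]; exact haΔ.1, hK a haΔ.1 haΔ.2⟩
          rw [ha, mem_singleton] at hmem
          exact mem_support.1 haΔ.1 hmem
        generalize #{a ∈ Δ | g a ∈ Δ} = X at hX ⊢
        rcases X with _ | _ | X
        · simp
        · simp at hX
        · suffices X + 1 + 1 ≤ (X + 1 + 1) * (X + 1 + 1) - (X + 1 + 1) by omega
          apply Nat.le_sub_of_add_le
          nlinarith
    rw [← mul_sum, sum_add_distrib, sum_card_filter_mapsTo hN, sum_card_filter_pair_mapsTo hM _ _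
      (fun q hq => (mem_offDiag.1 hq).2.2), sum_card_filter_pair_mapsTo hM _ _ hSne, hScard,
      offDiag_card] at hle
    obtain ⟨m, hm'⟩ : ∃ m, #Δ = m + 1 := ⟨#Δ - 1, by omega⟩
    have e : (m + 1) * (m + 1) - (m + 1) = (m + 1) * m := by
      rw [Nat.mul_succ]; simp
    rw [hm', Nat.add_sub_cancel] at hm
    rw [hm', e] at hle
    have : (m + 1) ^ 2 * M * (2 * (Fintype.card α - 1)) ≤
        (m + 1) ^ 2 * M * ((m + 1) * m) := by nlinarith
    have := Nat.le_of_mul_le_mul_left this (by positivity)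
    omega
  obtain ⟨z, hzG, hz1, hz⟩ := exists_commutator_mem ht hg hga hgta
  refine alternatingGroup_le_of_card_support_sq_lt h2 hzG hz1 ?_
  rw [← hΔ] at hz
  have : #z.support - 1 ≤ 5 := by omega
  calc _ ≤ 5 ^ 2 := Nat.pow_le_pow_left this 2
    _ < _ := by omega

end TwoTransitive

section PrimeDegree

variable {p : ℕ} [hp : Fact p.Prime]

/-- The difference operator `h ↦ ∑ d ∈ D, (h(X + d) - h(X))`. -/
noncomputable def diffSum (D : Finset (ZMod p)) (h : (ZMod p)[X]) : (ZMod p)[X] :=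
  ∑ d ∈ D, (taylor d h - h)

lemma eval_diffSum (D : Finset (ZMod p)) (h : (ZMod p)[X]) (x : ZMod p) :
    (diffSum D h).eval x = ∑ d ∈ D, (h.eval (x + d) - h.eval x) := by
  simp [diffSum, eval_finsetSum, taylor_eval]

lemma coeff_diffSum (D : Finset (ZMod p)) (h : (ZMod p)[X]) (m : ℕ) :
    (diffSum D h).coeff m = ∑ i ∈ range h.natDegree,
      ((i + 1 + m).choose m : ZMod p) * h.coeff (i + 1 + m) * ∑ d ∈ D, d ^ (i + 1) := by
  simp_rw [mul_sum]
  rw [sum_comm, diffSum, finsetSum_coeff]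
  refine sum_congr rfl fun d _ => ?_
  rw [coeff_sub, taylor_coeff, eval_eq_sum_range' (n := h.natDegree + 1)
    ((natDegree_hasseDeriv_le h m).trans_lt (by omega)), sum_range_succ']
  simp [hasseDeriv_coeff]

/-- If the power sums of `D` of positive exponent less than `k` vanish, then `diffSum D` lowers
degrees by at least `k`. -/
lemma coeff_diffSum_eq_zero {D : Finset (ZMod p)} {k : ℕ}
    (hk : ∀ i, 1 ≤ i → i < k → ∑ d ∈ D, d ^ i = 0) (h : (ZMod p)[X]) {m : ℕ}
    (hm : h.natDegree < m + k) : (diffSum D h).coeff m = 0 := by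
  rw [coeff_diffSum]
  refine sum_eq_zero fun i _ => ?_
  by_cases hi : i + 1 < k
  · rw [hk _ (by omega) hi, mul_zero]
  · rw [coeff_eq_zero_of_natDegree_lt (by omega), mul_zero, zero_mul]

lemma coeff_diffSum_natDegree_sub_ne_zero {D : Finset (ZMod p)} {k : ℕ} (hk0 : 1 ≤ k)
    (hk : ∀ i, 1 ≤ i → i < k → ∑ d ∈ D, d ^ i = 0) (hk' : ∑ d ∈ D, d ^ k ≠ 0)
    {h : (ZMod p)[X]} (h0 : h ≠ 0) (hkh : k ≤ h.natDegree) (hh : h.natDegree < p) :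
    (diffSum D h).coeff (h.natDegree - k) ≠ 0 := by
  rw [coeff_diffSum, sum_eq_single (k - 1)]
  · rw [Nat.sub_add_cancel hk0, Nat.add_sub_cancel' hkh]
    refine mul_ne_zero (mul_ne_zero ?_ (by simpa using h0)) hk'
    rw [Ne, ZMod.natCast_eq_zero_iff]
    intro hdvd
    have := (Nat.choose_mul_factorial_mul_factorial (Nat.sub_le h.natDegree k))
    have h2 : p ∣ h.natDegree.factorial := by
      rw [← this, mul_assoc]
      exact Dvd.dvd.mul_right hdvd _
    rw [hp.out.dvd_factorial] at h2
    omega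
  · intro i _ hik
    by_cases hi : i + 1 < k
    · rw [hk _ (by omega) hi, mul_zero]
    · rw [coeff_eq_zero_of_natDegree_lt (by omega), mul_zero, zero_mul]
  · intro hmem
    rw [mem_range] at hmem
    omega

/-- A nonempty set of nonzero elements has a nonvanishing power sum of small positive exponent. -/
lemma exists_sum_pow_ne_zero {D : Finset (ZMod p)} (hD : D.Nonempty) (h0 : (0 : ZMod p) ∉ D) :
    ∃ k, 1 ≤ k ∧ k ≤ #D ∧ ∑ d ∈ D, d ^ k ≠ 0 := by
  obtain ⟨d₀, hd₀⟩ := hD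
  set q : (ZMod p)[X] := X * ∏ d ∈ D.erase d₀, (X - C d) with hq
  have hdeg : q.natDegree = #D := by
    rw [hq, natDegree_X_mul (monic_prod_of_monic _ _ fun d _ => monic_X_sub_C d).ne_zero,
      natDegree_prod_of_monic _ _ fun d _ => monic_X_sub_C d]
    simp [card_erase_of_mem hd₀]
    have := card_pos.2 ⟨d₀, hd₀⟩
    omega
  by_contra! hcon
  have h1 : ∑ d ∈ D, q.eval d = q.eval d₀ := by
    rw [sum_eq_single_of_mem d₀ hd₀]
    intro d hd hne
    rw [hq, eval_mul, eval_prod, prod_eq_zero (mem_erase.2 ⟨hne, hd⟩) (by simp), mul_zero]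
  have h2 : ∑ d ∈ D, q.eval d = 0 := by
    simp_rw [eval_eq_sum_range]
    rw [sum_comm]
    refine sum_eq_zero fun i hi => ?_
    rw [← mul_sum]
    rcases Nat.eq_zero_or_pos i with rfl | hi0
    · simp [hq]
    · rw [hcon i hi0 (by rw [mem_range, hdeg] at hi; omega), mul_zero]
  have h3 : q.eval d₀ ≠ 0 := by
    rw [hq, eval_mul, eval_prod, eval_X]
    refine mul_ne_zero (fun h => h0 (h ▸ hd₀)) (prod_ne_zero_iff.2 fun d hd => ?_)
    rw [eval_sub, eval_X, eval_C, sub_ne_zero]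
    exact (ne_of_mem_erase hd).symm
  exact h3 (h1 ▸ h2)

/-- A permutation of `ZMod p` preserving the set of ordered pairs with difference in `D`, where
`D` is a set of less than `p / 2` nonzero elements, is affine. -/
lemma exists_affine_of_map_sub_mem {D : Finset (ZMod p)} (hD : D.Nonempty)
    (h0 : (0 : ZMod p) ∉ D) (hDp : 2 * #D < p) (g : Perm (ZMod p))
    (hg : ∀ x, ∀ d ∈ D, g (x + d) - g x ∈ D) : ∃ u v : ZMod p, ∀ x, g x = u * x + v := by
  classical
  have hex := exists_sum_pow_ne_zero hD h0
  set k := Nat.find hex with hkdef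
  obtain ⟨hk0, hkD, hk'⟩ := Nat.find_spec hex
  rw [← hkdef] at hk0 hkD hk'
  have hk : ∀ i, 1 ≤ i → i < k → ∑ d ∈ D, d ^ i = 0 := by
    intro i hi hik
    by_contra hne
    exact Nat.find_min hex hik ⟨hi, by omega, hne⟩
  have hsum : ∀ (φ : ZMod p → ZMod p) (x : ZMod p),
      ∑ d ∈ D, φ (g (x + d)) = ∑ d ∈ D, φ (g x + d) := by
    intro φ x
    have hinj : Set.InjOn (fun d => g (x + d) - g x) D := by
      intro a _ b _ hab
      simpa using hab
    have himg : D.image (fun d => g (x + d) - g x) = D := by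
      apply eq_of_subset_of_card_le
      · intro y hy
        obtain ⟨d, hd, rfl⟩ := mem_image.1 hy
        exact hg x d hd
      · rw [card_image_of_injOn hinj]
    conv_rhs => rw [← himg, sum_image hinj]
    simp
  set P : (ZMod p)[X] := Lagrange.interpolate univ id g with hP
  have hPe : ∀ x, P.eval x = g x := fun x =>
    Lagrange.eval_interpolate_at_node (v := id) g (Set.injOn_id _) (mem_univ x)
  have hPdeg : P.degree < p := by
    have := Lagrange.degree_interpolate_lt (s := univ) (v := id) g (Set.injOn_id _)
    rwa [card_univ, ZMod.card] at this
  have hext : ∀ Q R : (ZMod p)[X], Q.natDegree < p → R.natDegree < p →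
      (∀ x, Q.eval x = R.eval x) → Q = R := by
    intro Q R hQ hR h
    refine eq_of_natDegree_lt_card_of_eval_eq' Q R univ (fun x _ => h x) ?_
    rw [card_univ, ZMod.card]
    exact max_lt hQ hR
  set n := P.natDegree with hn
  have hnp : n < p := by
    rcases eq_or_ne P 0 with h | h
    · rw [hn, h]; simpa using hp.out.pos
    · exact (natDegree_lt_iff_degree_lt h).2 hPdeg
  rcases Nat.lt_or_ge n 2 with hn2 | hn2
  · refine ⟨P.coeff 1, P.coeff 0, fun x => ?_⟩
    rw [← hPe x, eval_eq_sum_range' (n := 2) hn2]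
    simp [sum_range_succ, add_comm]
  exfalso
  obtain ⟨j, hkj, hjp⟩ : ∃ j, k ≤ j * n ∧ j * n < p := by
    rcases Nat.lt_or_ge n k with hnk | hnk
    · refine ⟨k / n + 1, ?_, ?_⟩
      · have := Nat.div_add_mod k n
        have := Nat.mod_lt k (show 0 < n by omega)
        nlinarith
      · have := Nat.div_mul_le_self k n
        nlinarith
    · exact ⟨1, by omega, by omega⟩
  have hP0 : P ≠ 0 := by
    intro h
    rw [hn, h] at hn2
    simp at hn2
  have hdegj : (P ^ j).natDegree = j * n := natDegree_pow P j
  have hXj : diffSum D (X ^ j) = 0 ∨ k ≤ j ∧ (diffSum D (X ^ j)).natDegree ≤ j - k := by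
    rcases Nat.lt_or_ge j k with hjk | hjk
    · left
      ext m
      exact coeff_diffSum_eq_zero hk _ (by rw [natDegree_X_pow]; omega)
    · right
      refine ⟨hjk, natDegree_le_iff_coeff_eq_zero.2 fun m hm => ?_⟩
      exact coeff_diffSum_eq_zero hk _ (by rw [natDegree_X_pow]; omega)
  obtain ⟨hcomp, hcompdeg⟩ : ((diffSum D (X ^ j)).comp P).coeff (j * n - k) = 0 ∧
      ((diffSum D (X ^ j)).comp P).natDegree < p := by
    rcases hXj with h | ⟨hkj', h⟩
    · simpa [h] using hp.out.pos
    · have hle : ((diffSum D (X ^ j)).comp P).natDegree ≤ (j - k) * n :=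
        natDegree_comp_le.trans (Nat.mul_le_mul_right n h)
      obtain ⟨i, rfl⟩ := Nat.exists_eq_add_of_le hkj'
      rw [Nat.add_sub_cancel_left] at hle
      have hlt : i * n < (k + i) * n - k := by
        apply Nat.lt_sub_of_add_lt
        nlinarith
      exact ⟨coeff_eq_zero_of_natDegree_lt (by omega), by omega⟩
  have heq : diffSum D (P ^ j) = (diffSum D (X ^ j)).comp P := by
    refine hext _ _ ?_ hcompdeg fun x => ?_
    · refine (natDegree_le_iff_coeff_eq_zero (n := j * n).2 fun m hm => ?_).trans_lt hjp
      exact coeff_diffSum_eq_zero hk _ (by omega)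
    · rw [eval_comp, eval_diffSum, eval_diffSum]
      simp only [eval_pow, eval_X, hPe, sum_sub_distrib]
      rw [hsum fun y => y ^ j]
  refine coeff_diffSum_natDegree_sub_ne_zero hk0 hk hk' (pow_ne_zero j hP0)
    (by omega) (by omega) ?_
  rw [heq, hdegj, hcomp]

/-- **Burnside's theorem**: a group of permutations of `ZMod p` containing the translations is
`2`-transitive, or consists of affine maps. -/
lemma two_transitive_of_addRight_mem {G : Subgroup (Perm (ZMod p))}
    (hG : Equiv.addRight (1 : ZMod p) ∈ G) {t : Perm (ZMod p)} (ht : t ∈ G)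
    (hta : ¬ ∃ u v : ZMod p, ∀ x, t x = u * x + v) (a b c d : ZMod p) (hab : a ≠ b)
    (hcd : c ≠ d) : ∃ g ∈ G, g a = c ∧ g b = d := by
  classical
  have htr : ∀ z : ZMod p, Equiv.addRight z ∈ G := by
    intro z
    have : Equiv.addRight z = (Equiv.addRight (1 : ZMod p)) ^ z.val := by
      simp
    rw [this]
    exact G.pow_mem hG _
  by_contra hcon
  let D : ZMod p → ZMod p → Finset (ZMod p) := fun a b => {z | ∃ g ∈ G, g b - g a = z}
  have hmem : ∀ a b z, z ∈ D a b ↔ ∃ g ∈ G, g b - g a = z := by simp [D]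
  have key : ∀ a b : ZMod p, a ≠ b → p ≤ 2 * #(D a b) := by
    intro a b hab
    by_contra! hlt
    refine hta (exists_affine_of_map_sub_mem (D := D a b) ⟨b - a, ?_⟩ ?_ hlt t ?_)
    · exact (hmem _ _ _).2 ⟨1, G.one_mem, rfl⟩
    · rw [hmem]
      rintro ⟨g, _, hg⟩
      exact hab (g.injective (sub_eq_zero.1 hg)).symm
    · intro x z hz
      obtain ⟨g, hg, rfl⟩ := (hmem _ _ _).1 hz
      refine (hmem _ _ _).2 ⟨t * Equiv.addRight (x - g a) * g,
        G.mul_mem (G.mul_mem ht (htr _)) hg, ?_⟩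
      simp only [mul_apply, coe_addRight, add_sub_cancel]
      congr 2
      ring
  have hdisj : Disjoint (D a b) (D c d) := by
    rw [disjoint_left]
    intro z hz hz'
    obtain ⟨g, hg, rfl⟩ := (hmem _ _ _).1 hz
    obtain ⟨h, hh, hgh⟩ := (hmem _ _ _).1 hz'
    refine hcon ⟨h⁻¹ * Equiv.addRight (h c - g a) * g,
      G.mul_mem (G.mul_mem (G.inv_mem hh) (htr _)) hg, ?_, ?_⟩
    · rw [mul_apply, mul_apply, inv_eq_iff_eq]
      simp
    · rw [mul_apply, mul_apply, inv_eq_iff_eq, coe_addRight]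
      linear_combination -hgh
  have hsub : D a b ∪ D c d ⊆ univ.erase 0 := by
    intro z hz
    rw [mem_erase]
    refine ⟨?_, mem_univ _⟩
    rintro rfl
    rw [mem_union, hmem, hmem] at hz
    rcases hz with ⟨g, _, hg⟩ | ⟨g, _, hg⟩
    · exact hab (g.injective (sub_eq_zero.1 hg)).symm
    · exact hcd (g.injective (sub_eq_zero.1 hg)).symm
  have hcard := card_le_card hsub
  rw [card_union_of_disjoint hdisj, card_erase_of_mem (mem_univ _), card_univ, ZMod.card] at hcard
  have h1 := key a b hab
  have h2 := key c d hcd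
  have := hp.out.pos
  omega

/-- An affine map of `ZMod p` other than the identity moves at least `p - 1` points. -/
lemma not_affine_of_card_support_lt {t : Perm (ZMod p)} (ht : t ≠ 1) (hs : #t.support + 1 < p) :
    ¬ ∃ u v : ZMod p, ∀ x, t x = u * x + v := by
  rintro ⟨u, v, h⟩
  have hc : 1 < #(t.supportᶜ) := by
    rw [card_compl, ZMod.card]
    omega
  obtain ⟨a, ha, b, hb, hab⟩ := one_lt_card.1 hc
  rw [mem_compl, notMem_support, h] at ha hb
  have hu : u = 1 := by
    have : (u - 1) * (a - b) = 0 := by linear_combination ha - hb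
    rcases mul_eq_zero.1 this with h' | h'
    · exact sub_eq_zero.1 h'
    · exact absurd (sub_eq_zero.1 h') hab
  have hv : v = 0 := by rw [hu] at ha; linear_combination ha
  exact ht (Equiv.ext fun x => by rw [h, hu, hv]; simp)

/-- A permutation of prime order `p` of a set with `p` elements is a `p`-cycle. -/
lemma cycleType_of_orderOf_eq_card {α : Type*} [Fintype α] [DecidableEq α]
    (hα : Fintype.card α = p) {c : Perm α} (hc : orderOf c = p) : c.cycleType = {p} := by
  have hcyc : c.IsCycle := isCycle_of_prime_order' (by rw [hc]; exact hp.out)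
    (by rw [hα, hc]; have := hp.out.pos; omega)
  rw [hcyc.cycleType, ← hcyc.orderOf, hc]

end PrimeDegree

/-- A group of permutations of `ZMod p` containing the translations and an element moving `2 * s`
points, where `p` is large compared to `s`, contains the alternating group. -/
lemma alternatingGroup_le_of_card_support_eq_two_mul {p s : ℕ} [hp : Fact p.Prime]
    {G : Subgroup (Perm (ZMod p))} (hG : Equiv.addRight (1 : ZMod p) ∈ G)
    {t : Perm (ZMod p)} (ht : t ∈ G) (hs : 1 ≤ s)
    (hp5 : 5 ≤ p) (hts : #t.support = 2 * s)
    (hineq : (s : ℝ) * ((s : ℝ) * Real.log s + 2 * Real.log s + 3) ≤ p) :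
    alternatingGroup (ZMod p) ≤ G := by
  have ht1 : t ≠ 1 := by
    rintro rfl
    simp at hts
    omega
  have hs1 : (1 : ℝ) ≤ s := by exact_mod_cast hs
  have hlog : 0 ≤ Real.log s := Real.log_nonneg hs1
  have h3s : 3 * s ≤ p := by
    have h1 : 0 ≤ (s : ℝ) * Real.log s := by positivity
    have h2 : 0 ≤ (s : ℝ) * (s * Real.log s) := by positivity
    have : (3 * s : ℝ) ≤ p := by linarith
    exact_mod_cast this
  have h2 := two_transitive_of_addRight_mem hG ht
    (not_affine_of_card_support_lt ht1 (by omega))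
  have l2 := Real.log_two_gt_d9
  rcases Nat.lt_or_ge s 4 with hs4 | hs4
  · refine alternatingGroup_le_of_card_support_sq_lt h2 ht ht1 ?_
    rw [hts, ZMod.card]
    interval_cases s
    · omega
    · have : (11 : ℝ) < p := by push_cast at hineq; linarith
      have : 11 < p := by exact_mod_cast this
      omega
    · have : (25 : ℝ) < p := by
        have := Real.log_three_gt_d9
        push_cast at hineq; linarith
      have : 25 < p := by exact_mod_cast this
      have : p ≠ 26 := by
        rintro rfl
        exact absurd hp.out (by norm_num)
      omega
  · have hs4' : (4 : ℝ) ≤ s := by exact_mod_cast hs4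
    have hlog4 : 2 * Real.log 2 ≤ Real.log s := by
      rw [← Real.log_rpow two_pos]
      apply Real.log_le_log (by positivity)
      norm_num
      exact hs4
    have hbound : (s : ℝ) * (2 * s - 1) + 1 < p ∧ (26 : ℝ) < p := by
      constructor
      · rcases Nat.lt_or_ge s 8 with hs8 | hs8
        · have hs8' : (s : ℝ) ≤ 8 := by exact_mod_cast hs8.le
          have : (s : ℝ) * (s * 1.386 + 2 * 1.386 + 3) ≤ p := by
            refine le_trans ?_ hineq
            gcongr <;> linarith
          nlinarith
        · have hs8' : (8 : ℝ) ≤ s := by exact_mod_cast hs8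
          have hlog8 : 3 * Real.log 2 ≤ Real.log s := by
            rw [← Real.log_rpow two_pos]
            apply Real.log_le_log (by positivity)
            norm_num
            exact hs8
          have : (s : ℝ) * (s * 2 + 2 * 2 + 3) ≤ p := by
            refine le_trans ?_ hineq
            gcongr <;> linarith
          nlinarith
      · have : (s : ℝ) * (s * 1.386 + 2 * 1.386 + 3) ≤ p := by
          refine le_trans ?_ hineq
          gcongr <;> linarith
        nlinarith
    refine alternatingGroup_le_of_card_support_mul_lt h2 ht ht1 ?_ ?_
    · rw [ZMod.card]
      exact_mod_cast hbound.2
    · have h1 : s * (2 * s - 1) + 1 < p := by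
        have := hbound.1
        rw [← Nat.cast_lt (α := ℝ)]
        push_cast [Nat.cast_sub (show 1 ≤ 2 * s by omega)]
        exact this
      rw [hts, ZMod.card, mul_assoc]
      omega

lemma card_support_permCongr {α β : Type*} [Fintype α] [DecidableEq α] [Fintype β]
    [DecidableEq β] (e : α ≃ β) (σ : Perm α) : #(e.permCongr σ).support = #σ.support := by
  symm
  refine card_equiv e fun x => ?_
  simp

/-- A subgroup containing the alternating group is the alternating group or the whole symmetric
group. -/
lemma eq_alternatingGroup_or_eq_top {α : Type*} [Fintype α] [DecidableEq α] [Nontrivial α]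
    {G : Subgroup (Perm α)} (h : alternatingGroup α ≤ G) : G = alternatingGroup α ∨ G = ⊤ := by
  have hdvd := Subgroup.index_dvd_of_le h
  rw [alternatingGroup.index_eq_two, Nat.dvd_prime Nat.prime_two] at hdvd
  rcases hdvd with h1 | h2
  · exact .inr (Subgroup.index_eq_one.1 h1)
  · exact .inl (eq_alternatingGroup_of_index_eq_two h2)

/-- Complex conjugation acts on the roots of `f` by moving exactly the non-real ones. -/
lemma card_support_galActionHom_conj {f : ℚ[X]}
    [Fact ((f.map (algebraMap ℚ ℂ)).Splits)] (hf : f ≠ 0) :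
    #(Gal.galActionHom f ℂ (Gal.restrict f ℂ (Complex.conjAe.restrictScalars ℚ))).support =
      {z : ℂ | aeval z f = 0 ∧ z.im ≠ 0}.ncard := by
  rw [← card_image_of_injective _ Subtype.coe_injective, ← Set.ncard_coe_finset]
  congr 1
  have hc : ∀ w : f.rootSet ℂ,
      Gal.galActionHom f ℂ (Gal.restrict f ℂ (Complex.conjAe.restrictScalars ℚ)) w = w ↔
        w.val.im = 0 := by
    intro w
    rw [Subtype.ext_iff, Gal.galActionHom_restrict]
    exact Complex.conj_eq_iff_im
  ext z
  simp only [coe_image, Set.mem_image, mem_coe, mem_support, Set.mem_ofPred_eq, ne_eq, hc]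
  constructor
  · rintro ⟨w, hw, rfl⟩
    exact ⟨(mem_rootSet.mp w.2).2, hw⟩
  · rintro ⟨hz1, hz2⟩
    exact ⟨⟨z, mem_rootSet.mpr ⟨hf, hz1⟩⟩, hz2, rfl⟩

/-- Jordan's criterion applied to Galois groups: if an irreducible polynomial of prime
degree `p ≥ 5` over `ℚ` has exactly `2 * s` non-real complex roots with `s ≥ 1` and
`s * (s * log s + 2 * log s + 3) ≤ p`, then its Galois group is `A_p` or `S_p`. -/
theorem galois_group_eq_alternating_or_symmetric_of_nonreal_roots
    (f : ℚ[X]) (p s : ℕ) (hp : p.Prime) (hp5 : 5 ≤ p)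
    (hdeg : f.natDegree = p) (hirr : Irreducible f) (hs : 1 ≤ s)
    (hroots : {z : ℂ | aeval z f = 0 ∧ z.im ≠ 0}.ncard = 2 * s)
    (hineq : (s : ℝ) * ((s : ℝ) * Real.log s + 2 * Real.log s + 3) ≤ p) :
    Nonempty (f.Gal ≃* alternatingGroup (Fin p)) ∨
      Nonempty (f.Gal ≃* Equiv.Perm (Fin p)) := by
  classical
  have : Fact p.Prime := ⟨hp⟩
  have : Fact ((f.map (algebraMap ℚ ℂ)).Splits) := Gal.splits_ℚ_ℂ
  have : Nontrivial (ZMod p) := ZMod.nontrivial_iff.2 (by omega)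
  have hcard : Fintype.card (f.rootSet ℂ) = p := by
    rw [card_rootSet_eq_natDegree hirr.separable (IsAlgClosed.splits _), hdeg]
  have hdvd : p ∣ Nat.card f.Gal := by
    rw [← hdeg]
    exact Gal.prime_degree_dvd_card hirr (hdeg ▸ hp)
  have hinj := Gal.galActionHom_injective f ℂ
  obtain ⟨c, hc⟩ := exists_prime_orderOf_dvd_card' p hdvd
  have hone : (Equiv.addRight (1 : ZMod p)).cycleType = {p} := by
    refine cycleType_of_orderOf_eq_card (ZMod.card p) (orderOf_eq_prime ?_ ?_)
    · simp
    · intro h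
      have := Equiv.congr_fun h 0
      simp at this
  have e₀ : f.rootSet ℂ ≃ ZMod p := Fintype.equivOfCardEq (by rw [hcard, ZMod.card])
  obtain ⟨e, he⟩ : ∃ e : f.rootSet ℂ ≃ ZMod p,
      e.permCongr (Gal.galActionHom f ℂ c) = Equiv.addRight (1 : ZMod p) := by
    have : IsConj (e₀.permCongr (Gal.galActionHom f ℂ c)) (Equiv.addRight (1 : ZMod p)) := by
      rw [isConj_iff_cycleType_eq, hone]
      refine cycleType_of_orderOf_eq_card (ZMod.card p) ?_
      rw [← e₀.permCongrHom_coe, MulEquiv.orderOf_eq, orderOf_injective _ hinj, hc]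
    obtain ⟨u, hu⟩ := isConj_iff.1 this
    refine ⟨e₀.trans u, ?_⟩
    rw [← hu]
    ext x
    rfl
  set φ : f.Gal →* Perm (ZMod p) := e.permCongrHom.toMonoidHom.comp (Gal.galActionHom f ℂ) with hφ
  have hφinj : Function.Injective φ := e.permCongrHom.injective.comp hinj
  have hle : alternatingGroup (ZMod p) ≤ φ.range := by
    refine alternatingGroup_le_of_card_support_eq_two_mul ⟨c, he⟩
      ⟨Gal.restrict f ℂ (Complex.conjAe.restrictScalars ℚ), rfl⟩ hs hp5 ?_ hineq
    rw [← hroots, ← card_support_galActionHom_conj hirr.ne_zero]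
    exact card_support_permCongr e _
  have eG : f.Gal ≃* φ.range := MonoidHom.ofInjective hφinj
  have e' : ZMod p ≃ Fin p := Fintype.equivOfCardEq (by simp)
  rcases eq_alternatingGroup_or_eq_top hle with h | h
  · exact .inl ⟨(eG.trans (MulEquiv.subgroupCongr h)).trans e'.altCongrHom⟩
  · exact .inr ⟨((eG.trans (MulEquiv.subgroupCongr h)).trans Subgroup.topEquiv).trans
      e'.permCongrHom⟩
end

section
/- Let f ∈ ℚ[x] be an irreducible polynomial of prime degree p with p > 13. If f has exactly 6 non-real complex roots, then the Galois group of f over ℚ is isomorphic to the alternating group A_p or to the symmetric group S_p. -/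
open Polynomial

/-- Some power sum of positive exponent at most `#U` does not vanish on `U`. -/
lemma exists_sum_pow_ne_zero_s2 {K : Type*} [Field K] [DecidableEq K] (U : Finset K)
    (hU : U.Nonempty) (h0 : (0 : K) ∉ U) :
    ∃ r, 0 < r ∧ r ≤ U.card ∧ ∑ u ∈ U, u ^ r ≠ 0 := by
  by_contra! h
  obtain ⟨v, hv⟩ := hU
  set q : K[X] := ∏ w ∈ U.erase v, (X - C w) with hq
  have hqd : q.natDegree + 1 = U.card := by
    rw [hq, natDegree_prod_of_monic _ _ fun w _ => monic_X_sub_C w]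
    simp [Finset.card_erase_of_mem hv]
    have := Finset.card_pos.mpr ⟨v, hv⟩
    omega
  have h1 : ∑ u ∈ U, u * q.eval u = 0 := by
    simp_rw [eval_eq_sum_range, Finset.mul_sum]
    rw [Finset.sum_comm]
    refine Finset.sum_eq_zero fun i hi => ?_
    have := h (i + 1) (by omega) (by have := Finset.mem_range.mp hi; omega)
    calc ∑ u ∈ U, u * (q.coeff i * u ^ i) = q.coeff i * ∑ u ∈ U, u ^ (i + 1) := by
          rw [Finset.mul_sum]; exact Finset.sum_congr rfl fun u _ => by ring
      _ = 0 := by rw [this, mul_zero]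
  rw [Finset.sum_eq_single_of_mem v hv] at h1
  · rcases mul_eq_zero.mp h1 with h1 | h1
    · exact h0 (h1 ▸ hv)
    · rw [hq, eval_prod, Finset.prod_eq_zero_iff] at h1
      obtain ⟨w, hw, h1⟩ := h1
      simp only [eval_sub, eval_X, eval_C, sub_eq_zero] at h1
      exact (Finset.mem_erase.mp hw).1 h1.symm
  · intro u hu huv
    rw [hq, eval_prod, Finset.prod_eq_zero (Finset.mem_erase.mpr ⟨huv, hu⟩) (by simp), mul_zero]

/-- A permutation of `ZMod p` preserving a Cayley digraph of small valency is trivial as soon as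
it has many fixed points. -/
lemma perm_eq_one_of_forall_sub_mem {p : ℕ} [Fact p.Prime] (U : Finset (ZMod p))
    (hU : U.Nonempty) (h0 : (0 : ZMod p) ∉ U) (t : Equiv.Perm (ZMod p))
    (hcard : U.card + t.support.card < p) (hcard' : 1 + t.support.card < p)
    (ht : ∀ x, ∀ u ∈ U, t (x + u) - t x ∈ U) : t = 1 := by
  by_contra ht1
  have hp : 0 < p := Nat.pos_of_neZero p
  obtain ⟨r, ⟨hr0, hrU, hr⟩, hmin⟩ : ∃ r, (0 < r ∧ r ≤ U.card ∧ ∑ u ∈ U, u ^ r ≠ 0) ∧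
      ∀ k, 0 < k → k < r → ∑ u ∈ U, u ^ k = 0 := by
    have hex := exists_sum_pow_ne_zero_s2 U hU h0
    classical
    refine ⟨Nat.find hex, Nat.find_spec hex, fun k hk hkr => ?_⟩
    by_contra hne
    exact Nat.find_min hex hkr ⟨hk, (hkr.le.trans (Nat.find_spec hex).2.1), hne⟩
  have hsum : ∀ x, ∑ u ∈ U, (t (x + u) - t x) = ∑ u ∈ U, u := by
    intro x
    have hinj : Set.InjOn (fun u => t (x + u) - t x) U := fun u _ v _ h => by simpa using h
    rw [← Finset.sum_image (f := fun u => u) hinj]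
    congr 1
    apply Finset.eq_of_subset_of_card_le
    · intro y hy
      obtain ⟨u, hu, rfl⟩ := Finset.mem_image.mp hy
      exact ht x u hu
    · rw [Finset.card_image_of_injOn hinj]
  obtain ⟨f, hfd, hf⟩ : ∃ f : (ZMod p)[X], f.degree < (p : ℕ) ∧ ∀ x, f.eval x = t x := by
    refine ⟨Lagrange.interpolate Finset.univ id t, ?_, fun x => ?_⟩
    · simpa [ZMod.card] using
        Lagrange.degree_interpolate_lt (s := Finset.univ) (v := id) t (Set.injOn_id _)
    · simpa using
        Lagrange.eval_interpolate_at_node (v := id) t (Set.injOn_id _) (Finset.mem_univ x)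
  have zero_of_eval : ∀ g : (ZMod p)[X], g.degree < (p : ℕ) → (∀ x, g.eval x = 0) → g = 0 := by
    intro g hg hx
    refine Polynomial.eq_zero_of_degree_lt_of_eval_finset_eq_zero Finset.univ ?_ fun x _ => hx x
    simpa [ZMod.card] using hg
  have hfX : f - X ≠ 0 := by
    intro h
    apply ht1
    ext x
    simp [← hf, sub_eq_zero.mp h]
  have hfix : p ≤ (f - X).natDegree + t.support.card := by
    have h1 : (Finset.univ \ t.support).card ≤ (f - X).natDegree := by
      by_contra! h
      refine hfX (Polynomial.eq_zero_of_natDegree_lt_card_of_eval_eq_zero' _ _ (fun x hx => ?_) h)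
      simp only [Finset.mem_sdiff, Finset.mem_univ, Equiv.Perm.mem_support, not_not,
        true_and] at hx
      simp [hf, hx]
    rw [Finset.card_sdiff_of_subset (Finset.subset_univ _), Finset.card_univ, ZMod.card] at h1
    omega
  have hn : p ≤ f.natDegree + t.support.card := by
    have := natDegree_sub_le f (X : (ZMod p)[X])
    rw [natDegree_X] at this
    omega
  have hf0 : f ≠ 0 := by rintro rfl; simp at hn; omega
  have hnp : f.natDegree < p := by rwa [natDegree_lt_iff_degree_lt hf0]
  set Q : (ZMod p)[X] := ∑ u ∈ U, (taylor u f - f) - C (∑ u ∈ U, u) with hQ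
  have hQ0 : Q = 0 := by
    apply zero_of_eval
    · refine (degree_sub_le _ _).trans_lt (max_lt ?_ ?_)
      · refine (degree_sum_le _ _).trans_lt ((Finset.sup_lt_iff (WithBot.bot_lt_coe p)).mpr
          fun u _ => (degree_sub_le _ _).trans_lt (max_lt ?_ hfd))
        rwa [degree_taylor]
      · exact degree_C_le.trans_lt (by exact_mod_cast hp)
    · intro x
      simp only [hQ, eval_sub, eval_finsetSum, taylor_eval, eval_C, hf]
      rw [← hsum x]
      simp
  have hcoeff : Q.coeff (f.natDegree - r) =
      (f.natDegree.choose (f.natDegree - r)) * f.leadingCoeff * ∑ u ∈ U, u ^ r := by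
    set n := f.natDegree
    obtain ⟨m, hm⟩ : ∃ m, n = m + 1 + r := ⟨n - r - 1, by omega⟩
    have h1 : n - r = m + 1 := by omega
    have h2 : ∀ u, (taylor u f - f).coeff (m + 1) =
        ∑ k ∈ Finset.range r, ((m + 1 + (k + 1)).choose (m + 1)) *
          f.coeff (m + 1 + (k + 1)) * u ^ (k + 1) := by
      intro u
      rw [coeff_sub, taylor_coeff]
      have hd : (hasseDeriv (m + 1) f).natDegree < r + 1 := by
        refine (natDegree_hasseDeriv_le f (m+1)).trans_lt ?_
        omega
      rw [eval_eq_sum_range' hd, Finset.sum_range_succ']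
      simp only [hasseDeriv_coeff]
      simp [add_comm]
    rw [h1, hQ, coeff_sub, finsetSum_coeff, coeff_C_succ, sub_zero]
    simp_rw [h2]
    rw [Finset.sum_comm]
    simp_rw [← Finset.mul_sum]
    rw [Finset.sum_eq_single_of_mem (r - 1) (Finset.mem_range.mpr (by omega))]
    · have h3 : r - 1 + 1 = r := by omega
      rw [h3, ← hm]; rfl
    · intro k hk hkr
      have := Finset.mem_range.mp hk
      rw [hmin (k + 1) (by omega) (by omega), mul_zero]
  rw [hQ0, coeff_zero, eq_comm, mul_eq_zero, mul_eq_zero] at hcoeff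
  rcases hcoeff with (h | h) | h
  · rw [ZMod.natCast_eq_zero_iff] at h
    have hdvd : p ∣ f.natDegree.factorial := by
      rw [← Nat.choose_mul_factorial_mul_factorial (Nat.sub_le f.natDegree r), mul_assoc]
      exact h.mul_right _
    have := (Nat.Prime.dvd_factorial Fact.out).mp hdvd
    omega
  · exact hf0 (leadingCoeff_eq_zero.mp h)
  · exact hr h

section

open Equiv.Perm

variable {α : Type*} [Fintype α] [DecidableEq α]

lemma support_commutator_subset (s t : Equiv.Perm α) :
    (s * t * s⁻¹ * t⁻¹).support ⊆ (s.support ∩ t.support) ∪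
      (s.support ∩ t.support).image s ∪ (s.support ∩ t.support).image t := by
  intro x hx
  by_contra h
  simp only [Finset.mem_union, Finset.mem_image, Finset.mem_inter, mem_support, not_or, not_and,
    not_exists, not_not, ne_eq] at h
  obtain ⟨⟨h1, h2⟩, h3⟩ := h
  have happ : ∀ g : Equiv.Perm α, g (g⁻¹ x) = x := fun g => g.apply_symm_apply x
  have h2' := h2 (s⁻¹ x)
  have h3' := h3 (t⁻¹ x)
  rw [happ] at h2' h3'
  rw [mem_support] at hx
  apply hx
  simp only [mul_apply]
  by_cases hs : s x = x
  · have hsi : s⁻¹ x = x := by rw [inv_eq_iff_eq, hs]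
    by_cases ht : t x = x
    · have hti : t⁻¹ x = x := by rw [inv_eq_iff_eq, ht]
      rw [hti, hsi, ht, hs]
    · have h4 : s (t⁻¹ x) = t⁻¹ x := by
        by_contra h4
        exact h3' ⟨h4, fun h => ht (by nth_rw 1 [h]; exact happ t)⟩ rfl
      have : s⁻¹ (t⁻¹ x) = t⁻¹ x := by rw [inv_eq_iff_eq, h4]
      rw [this, happ, hs]
  · have ht := h1 hs
    have hti : t⁻¹ x = x := by rw [inv_eq_iff_eq, ht]
    have h4 : t (s⁻¹ x) = s⁻¹ x := by
      by_contra h4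
      exact h2' ⟨fun h => hs (by nth_rw 1 [h]; exact happ s), h4⟩ rfl
    rw [hti, h4, happ]

variable (K : Subgroup (Equiv.Perm α)) [DecidablePred (· ∈ K)]

lemma card_mul_card_filter_apply_eq (s : Finset α) (hK : ∀ g ∈ K, ∀ x ∈ s, g x ∈ s)
    (htr : ∀ x ∈ s, ∀ y ∈ s, ∃ g ∈ K, g x = y) {x y : α} (hx : x ∈ s) (hy : y ∈ s) :
    s.card * (Finset.univ.filter fun g => g ∈ K ∧ g x = y).card =
      (Finset.univ.filter (· ∈ K)).card := by
  have hmaps : ∀ g ∈ Finset.univ.filter (· ∈ K), g x ∈ s := fun g hg =>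
    hK g (Finset.mem_filter.mp hg).2 x hx
  rw [Finset.card_eq_sum_card_fiberwise hmaps, ← smul_eq_mul, ← Finset.sum_const]
  refine Finset.sum_congr rfl fun z hz => ?_
  obtain ⟨k, hk, rfl⟩ := htr y hy z hz
  rw [Finset.filter_filter]
  refine Finset.card_bij (fun g _ => k * g) ?_ ?_ ?_
  · intro g hg
    simp only [Finset.mem_filter, Finset.mem_univ, true_and] at hg ⊢
    exact ⟨K.mul_mem hk hg.1, by rw [mul_apply, hg.2]⟩
  · intro g _ h _ hgh
    exact mul_left_cancel hgh
  · intro g hg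
    simp only [Finset.mem_filter, Finset.mem_univ, true_and] at hg
    refine ⟨k⁻¹ * g, ?_, by simp⟩
    simp only [Finset.mem_filter, Finset.mem_univ, true_and]
    exact ⟨K.mul_mem (K.inv_mem hk) hg.1, by rw [mul_apply, hg.2]; exact k.symm_apply_apply y⟩

/-- The exact average of `#(g X ∩ Y)` over a group acting transitively on `s`. -/
lemma card_mul_sum_card_filter_apply_mem (s : Finset α) (hK : ∀ g ∈ K, ∀ x ∈ s, g x ∈ s)
    (htr : ∀ x ∈ s, ∀ y ∈ s, ∃ g ∈ K, g x = y) {X Y : Finset α} (hX : X ⊆ s) (hY : Y ⊆ s) :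
    s.card * ∑ g with g ∈ K, (X.filter fun x => g x ∈ Y).card =
      X.card * Y.card * (Finset.univ.filter (· ∈ K)).card := by
  have h1 : ∀ g : Equiv.Perm α, (X.filter fun x => g x ∈ Y).card =
      ∑ x ∈ X, ∑ y ∈ Y, if g x = y then 1 else 0 := by
    intro g
    rw [Finset.card_filter]
    exact Finset.sum_congr rfl fun x _ => by simp
  simp_rw [h1]
  rw [Finset.sum_comm]
  simp_rw [Finset.sum_comm (s := Finset.univ.filter (· ∈ K))]
  simp_rw [← Finset.card_filter, Finset.filter_filter, Finset.mul_sum]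
  rw [Finset.sum_congr rfl fun x hx => Finset.sum_congr rfl fun y hy =>
    card_mul_card_filter_apply_eq K s hK htr (hX hx) (hY hy)]
  simp [mul_assoc]

/-- A lower bound for the average of `#(g T ∩ T)` over a group preserving `s ⊇ T`. -/
lemma card_sq_mul_card_le_card_mul_sum (s : Finset α) (hK : ∀ g ∈ K, ∀ x ∈ s, g x ∈ s)
    {T : Finset α} (hT : T ⊆ s) :
    T.card ^ 2 * (Finset.univ.filter (· ∈ K)).card ≤
      s.card * ∑ g with g ∈ K, (T.filter fun x => g x ∈ T).card := by
  set H := Finset.univ.filter (· ∈ K) with hH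
  have hmem : ∀ g, g ∈ H ↔ g ∈ K := fun g => by simp [hH]
  have hHpos : 0 < H.card := Finset.card_pos.mpr ⟨1, (hmem 1).mpr K.one_mem⟩
  have h1 : ∑ x ∈ s, (H.filter fun g => g x ∈ T).card = H.card * T.card := by
    simp_rw [Finset.card_filter]
    rw [Finset.sum_comm]
    simp_rw [← Finset.card_filter]
    rw [← smul_eq_mul, ← Finset.sum_const]
    refine Finset.sum_congr rfl fun g hg => ?_
    refine Finset.card_bij (fun x _ => g x) (fun x hx => (Finset.mem_filter.mp hx).2)
      (fun x _ y _ h => g.injective h) fun y hy => ⟨g⁻¹ y, ?_, g.apply_symm_apply y⟩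
    exact Finset.mem_filter.mpr ⟨hK _ (K.inv_mem ((hmem g).mp hg)) y (hT hy),
      (g.apply_symm_apply y).symm ▸ hy⟩
  have h2 : ∑ x ∈ s, (H.filter fun g => g x ∈ T).card ^ 2 =
      H.card * ∑ g ∈ H, (T.filter fun x => g x ∈ T).card := by
    simp_rw [Finset.card_filter, sq, Finset.sum_mul_sum]
    rw [Finset.sum_comm, ← smul_eq_mul, ← Finset.sum_const]
    refine Finset.sum_congr rfl fun g hg => ?_
    have hg' := (hmem g).mp hg
    rw [Finset.sum_comm]
    refine Finset.sum_bij (fun k _ => k * g⁻¹) ?_ ?_ ?_ ?_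
    · exact fun k hk => (hmem _).mpr (K.mul_mem ((hmem k).mp hk) (K.inv_mem hg'))
    · exact fun k _ l _ h => mul_right_cancel h
    · exact fun k hk => ⟨k * g, (hmem _).mpr (K.mul_mem ((hmem k).mp hk) hg'), by simp⟩
    · intro k hk
      simp_rw [ite_zero_mul_ite_zero, mul_one, ← Finset.card_filter]
      refine Finset.card_bij (fun x _ => g x) ?_ (fun x _ y _ h => g.injective h) ?_
      · intro x hx
        simp only [Finset.mem_filter] at hx ⊢
        refine ⟨hx.2.1, ?_⟩
        have : (k * g⁻¹) (g x) = k x := congrArg k (g.symm_apply_apply x)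
        rw [this]
        exact hx.2.2
      · intro y hy
        simp only [Finset.mem_filter] at hy
        refine ⟨g⁻¹ y, ?_, g.apply_symm_apply y⟩
        simp only [Finset.mem_filter]
        exact ⟨hK _ (K.inv_mem hg') y (hT hy.1), (g.apply_symm_apply y).symm ▸ hy.1, hy.2⟩
  have h3 := sq_sum_le_card_mul_sum_sq (s := s) (f := fun x => (H.filter fun g => g x ∈ T).card)
  rw [h1, h2] at h3
  refine Nat.le_of_mul_le_mul_left ?_ hHpos
  calc _ = (H.card * T.card) ^ 2 := by ring
    _ ≤ _ := h3
    _ = _ := by rw [Nat.cast_id]; ring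

variable (G : Subgroup (Equiv.Perm α))

lemma alternatingGroup_le_of_commutator [MulAction.IsPreprimitive G α] {s t : Equiv.Perm α}
    (hs : s ∈ G) (ht : t ∈ G) {a : α} (h : s.support ∩ t.support = {a}) :
    alternatingGroup α ≤ G := by
  set c := s * t * s⁻¹ * t⁻¹ with hc
  have hcG : c ∈ G := G.mul_mem (G.mul_mem (G.mul_mem hs ht) (G.inv_mem hs)) (G.inv_mem ht)
  have hcard : c.support.card ≤ 3 := by
    refine (Finset.card_le_card (support_commutator_subset s t)).trans ?_
    rw [h, Finset.image_singleton, Finset.image_singleton]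
    exact (Finset.card_union_le _ _).trans (Nat.add_le_add_right (Finset.card_union_le _ _) _)
  have ha : a ∈ s.support ∩ t.support := h ▸ Finset.mem_singleton_self a
  have hne : c ≠ 1 := by
    intro hc1
    have hcomm : s * t = t * s := by
      rw [← mul_inv_eq_one, mul_inv_rev, ← mul_assoc]; exact hc1
    have hsa : s a ∈ s.support ∩ t.support := by
      rw [Finset.mem_inter] at ha ⊢
      refine ⟨apply_mem_support.mpr ha.1, ?_⟩
      rw [mem_support] at ha ⊢
      intro h'
      have h2 : s (t a) = t (s a) := congrArg (fun g => g a) hcomm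
      rw [h'] at h2
      exact mem_support.mp ha.2 (s.injective h2)
    rw [h, Finset.mem_singleton] at hsa
    exact mem_support.mp (Finset.mem_inter.mp ha).1 hsa
  have h1 := one_lt_card_support_of_ne_one hne
  obtain h2 | h3 : c.support.card = 2 ∨ c.support.card = 3 := by omega
  · rw [subgroup_eq_top_of_isPreprimitive_of_isSwap_mem inferInstance c
      (card_support_eq_two.mp h2) hcG]
    exact le_top
  · exact alternatingGroup_le_of_isPreprimitive_of_isThreeCycle_mem inferInstance
      (card_support_eq_three_iff.mp h3) hcG

lemma mem_support_conj_iff (g t : Equiv.Perm α) (x : α) :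
    g x ∈ (g * t * g⁻¹).support ↔ x ∈ t.support := by
  simp [mem_support]

lemma card_support_inter_support_conj {t g : Equiv.Perm α} {a : α} (ha : a ∈ t.support)
    (hg : g a = a) : (t.support ∩ (g * t * g⁻¹).support).card =
      ((t.support.erase a).filter fun x => g x ∈ t.support.erase a).card + 1 := by
  have ha' : a ∈ t.support ∩ (g * t * g⁻¹).support := by
    refine Finset.mem_inter.mpr ⟨ha, ?_⟩
    have := (mem_support_conj_iff g t a).mpr ha
    rwa [hg] at this
  rw [← Finset.card_erase_add_one ha']
  congr 1
  symm
  refine Finset.card_bij (fun x _ => g x) ?_ (fun x _ y _ h => g.injective h) ?_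
  · intro x hx
    simp only [Finset.mem_filter, Finset.mem_erase, Finset.mem_inter] at hx ⊢
    exact ⟨hx.2.1, hx.2.2, (mem_support_conj_iff g t x).mpr hx.1.2⟩
  · intro y hy
    obtain ⟨x, rfl⟩ := g.surjective y
    simp only [Finset.mem_erase, Finset.mem_inter, mem_support_conj_iff] at hy
    refine ⟨x, ?_, rfl⟩
    simp only [Finset.mem_filter, Finset.mem_erase]
    exact ⟨⟨fun h => hy.1 (by rw [h, hg]), hy.2.2⟩, hy.1, hy.2.1⟩

omit [Fintype α] [DecidableEq α] in
lemma mem_inf_stabilizer_iff {a : α} {g : Equiv.Perm α} :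
    g ∈ G ⊓ MulAction.stabilizer (Equiv.Perm α) a ↔ g ∈ G ∧ g a = a := by
  simp [Subgroup.mem_inf, MulAction.mem_stabilizer_iff]

/-- A doubly transitive group of degree at least `17` containing a nontrivial permutation which
moves at most `5` points contains the alternating group. -/
lemma alternatingGroup_le_of_card_support_le_five [MulAction.IsPreprimitive G α]
    (h2 : ∀ a x y, x ≠ a → y ≠ a → ∃ g ∈ G, g a = a ∧ g x = y) (hcard : 17 ≤ Fintype.card α)
    {t : Equiv.Perm α} (ht : t ∈ G) (ht1 : t ≠ 1) (h5 : t.support.card ≤ 5) :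
    alternatingGroup α ≤ G := by
  classical
  have ht2 := one_lt_card_support_of_ne_one ht1
  obtain ⟨a, ha⟩ := Finset.card_pos.mp (zero_lt_one.trans ht2)
  set K := G ⊓ MulAction.stabilizer (Equiv.Perm α) a
  have hK : ∀ g, g ∈ K ↔ g ∈ G ∧ g a = a := fun g => mem_inf_stabilizer_iff G
  obtain ⟨g, hg, hw⟩ : ∃ g ∈ K,
      ((t.support.erase a).filter fun x => g x ∈ t.support.erase a).card = 0 := by
    by_contra! hne
    have hsum := card_mul_sum_card_filter_apply_mem K (Finset.univ.erase a)
      (fun g hg x hx => by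
        simp only [Finset.mem_erase, Finset.mem_univ, and_true] at hx ⊢
        exact fun h => hx (g.injective (h.trans ((hK g).mp hg).2.symm)))
      (fun x hx y hy => by
        obtain ⟨g, hg, hga, hgx⟩ := h2 a x y (Finset.ne_of_mem_erase hx) (Finset.ne_of_mem_erase hy)
        exact ⟨g, (hK g).mpr ⟨hg, hga⟩, hgx⟩)
      (Finset.erase_subset_erase a (Finset.subset_univ t.support))
      (Finset.erase_subset_erase a (Finset.subset_univ t.support))
    rw [Finset.card_erase_of_mem (Finset.mem_univ a), Finset.card_univ,
      Finset.card_erase_of_mem ha] at hsum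
    set H := Finset.univ.filter (· ∈ K) with hH
    set n := t.support.card - 1 with hn
    have h1H : (1 : Equiv.Perm α) ∈ H := by simp [hH, K.one_mem]
    have hHpos : 0 < H.card := Finset.card_pos.mpr ⟨1, h1H⟩
    have hlow : H.card - 1 + n ≤
        ∑ g ∈ H, ((t.support.erase a).filter fun x => g x ∈ t.support.erase a).card := by
      rw [← Finset.sum_erase_add _ _ h1H]
      refine add_le_add ?_ ?_
      · rw [← Finset.card_erase_of_mem h1H, Finset.card_eq_sum_ones]
        refine Finset.sum_le_sum fun g hg => ?_
        have := hne g (Finset.mem_filter.mp (Finset.mem_of_mem_erase hg)).2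
        omega
      · rw [Finset.filter_true_of_mem (p := fun x => (1 : Equiv.Perm α) x ∈ t.support.erase a)
          fun x hx => hx, Finset.card_erase_of_mem ha]
    obtain ⟨m, hm⟩ : ∃ m, H.card = m + 1 := ⟨H.card - 1, by omega⟩
    have h3 : 16 * (H.card - 1 + n) ≤ n * n * H.card := by
      rw [← hsum]
      exact Nat.mul_le_mul (by omega) hlow
    rw [hm] at h3
    have hn1 : 1 ≤ n := by omega
    have hn4 : n ≤ 4 := by omega
    interval_cases n <;> omega
  obtain ⟨hgG, hga⟩ := (hK g).mp hg
  have hone := card_support_inter_support_conj ha hga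
  rw [hw, zero_add, Finset.card_eq_one] at hone
  obtain ⟨b, hb⟩ := hone
  exact alternatingGroup_le_of_commutator G ht
    (G.mul_mem (G.mul_mem hgG ht) (G.inv_mem hgG)) hb

/-- If two involutions have a commutator moving at least `6` points, then their supports have a
large intersection. -/
lemma six_add_card_le_of_six_le_card_support {t u : Equiv.Perm α}
    (h : 6 ≤ (t * u * t⁻¹ * u⁻¹).support.card) :
    6 + ((t.support ∩ u.support).filter fun x => t x ∈ t.support ∩ u.support).card +
      ((t.support ∩ u.support).filter fun x => u x ∈ t.support ∩ u.support).card ≤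
      3 * (t.support ∩ u.support).card := by
  set I := t.support ∩ u.support with hI
  have himage : ∀ v : Equiv.Perm α,
      (I.image v \ I).card + (I.filter fun x => v x ∈ I).card = I.card := by
    intro v
    rw [← Finset.card_image_of_injective (I.filter fun x => v x ∈ I) v.injective]
    have h1 : (I.filter fun x => v x ∈ I).image v = I.image v ∩ I := by
      ext y
      simp only [Finset.mem_image, Finset.mem_filter, Finset.mem_inter]
      constructor
      · rintro ⟨x, ⟨hx, hvx⟩, rfl⟩
        exact ⟨⟨x, hx, rfl⟩, hvx⟩
      · rintro ⟨⟨x, hx, rfl⟩, hvx⟩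
        exact ⟨x, ⟨hx, hvx⟩, rfl⟩
    rw [h1, Finset.card_sdiff_add_card_inter, Finset.card_image_of_injective _ v.injective]
  have hsub : (t * u * t⁻¹ * u⁻¹).support ⊆ I ∪ (I.image t \ I) ∪ (I.image u \ I) := by
    intro x hx
    have := support_commutator_subset t u hx
    rw [← hI] at this
    simp only [Finset.mem_union, Finset.mem_sdiff] at this ⊢
    tauto
  have hc := (h.trans (Finset.card_le_card hsub)).trans
    ((Finset.card_union_le _ _).trans (Nat.add_le_add_right (Finset.card_union_le _ _) _))
  have := himage t
  have := himage u
  omega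

/-- Lower bound for the intersection of the supports of two involutions `t`, `u` moving `a`,
according to how `t` and `u` act on `a`. -/
lemma le_card_support_inter_support {t u : Equiv.Perm α} (ht : t * t = 1) (hu : u * u = 1)
    (h : 6 ≤ (t * u * t⁻¹ * u⁻¹).support.card ∨ t * u = u * t) {a : α}
    (hat : a ∈ t.support) (hau : a ∈ u.support) :
    2 + (if u a ∈ (t.support.erase a).erase (t a) then 1 else 0) +
      (if t a ∈ (u.support.erase a).erase (u a) then 1 else 0) ≤
      (t.support ∩ u.support).card := by
  have htt : ∀ x, t (t x) = x := fun x => congrArg (fun g => g x) ht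
  have huu : ∀ x, u (u x) = x := fun x => congrArg (fun g => g x) hu
  have hta : t a ≠ a := mem_support.mp hat
  have hua : u a ≠ a := mem_support.mp hau
  set I := t.support ∩ u.support with hI
  have haI : a ∈ I := Finset.mem_inter.mpr ⟨hat, hau⟩
  have hA : (u a ∈ (t.support.erase a).erase (t a)) → a ≠ u a ∧ u a ≠ t a ∧ u a ∈ I := by
    intro hA
    simp only [Finset.mem_erase] at hA
    exact ⟨hua.symm, hA.1, Finset.mem_inter.mpr ⟨hA.2.2, apply_mem_support.mpr hau⟩⟩
  have hB : (t a ∈ (u.support.erase a).erase (u a)) → a ≠ t a ∧ u a ≠ t a ∧ t a ∈ I := by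
    intro hB
    simp only [Finset.mem_erase] at hB
    exact ⟨hta.symm, hB.1.symm, Finset.mem_inter.mpr ⟨apply_mem_support.mpr hat, hB.2.2⟩⟩
  rcases h with h | h
  · have h6 := six_add_card_le_of_six_le_card_support h
    rw [← hI] at h6
    have hpair : ∀ v : Equiv.Perm α, (∀ x, v (v x) = x) → a ≠ v a → v a ∈ I →
        2 ≤ (I.filter fun x => v x ∈ I).card := by
      intro v hv hne hmem
      rw [← Finset.card_pair hne]
      refine Finset.card_le_card ?_
      intro x hx
      rw [Finset.mem_insert, Finset.mem_singleton] at hx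
      rcases hx with rfl | rfl
      · exact Finset.mem_filter.mpr ⟨haI, hmem⟩
      · exact Finset.mem_filter.mpr ⟨hmem, by rwa [hv]⟩
    split_ifs with h1 h2 h2
    · have := hpair u huu (hA h1).1 (hA h1).2.2
      have := hpair t htt (hB h2).1 (hB h2).2.2
      omega
    · have := hpair u huu (hA h1).1 (hA h1).2.2
      omega
    · have := hpair t htt (hB h2).1 (hB h2).2.2
      omega
    · omega
  · have hcomm : ∀ x, t (u x) = u (t x) := fun x => congrArg (fun g => g x) h
    have htI : ∀ x ∈ I, t x ∈ I := by
      intro x hx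
      simp only [hI, Finset.mem_inter, mem_support] at hx ⊢
      exact ⟨fun h => hx.1 (t.injective h), fun h => hx.2 (t.injective (by rw [hcomm, h]))⟩
    have huI : ∀ x ∈ I, u x ∈ I := by
      intro x hx
      simp only [hI, Finset.mem_inter, mem_support] at hx ⊢
      exact ⟨fun h => hx.1 (u.injective (by rw [← hcomm, h])), fun h => hx.2 (u.injective h)⟩
    by_cases hut : u a = t a
    · rw [if_neg fun h => (hA h).2.1 hut, if_neg fun h => (hB h).2.1 hut]
      calc 2 = ({a, t a} : Finset α).card := (Finset.card_pair hta.symm).symm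
        _ ≤ I.card := Finset.card_le_card (by
          simp [Finset.insert_subset_iff, haI, htI a haI])
    · have h4 : ({a, t a, u a, t (u a)} : Finset α).card = 4 := by
        have h1 : t (u a) ≠ a := fun h => hut (by rw [← h, htt, h])
        have h2 : t (u a) ≠ t a := fun h => hua (t.injective h)
        have h3 : t (u a) ≠ u a := mem_support.mp (Finset.mem_inter.mp (huI a haI)).1
        rw [Finset.card_insert_of_notMem, Finset.card_insert_of_notMem, Finset.card_pair h3.symm]
        · simp [Ne.symm hut, h2.symm]
        · simp [hta.symm, hua.symm, h1.symm]
      have : ({a, t a, u a, t (u a)} : Finset α).card ≤ I.card := Finset.card_le_card (by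
          simp [Finset.insert_subset_iff, haI, htI a haI, huI a haI, htI _ (huI a haI)])
      split_ifs <;> omega

/-- A doubly transitive group of degree at least `17` containing a product of three disjoint
transpositions contains the alternating group. -/
lemma alternatingGroup_le_of_involution [MulAction.IsPreprimitive G α]
    (h2 : ∀ a x y, x ≠ a → y ≠ a → ∃ g ∈ G, g a = a ∧ g x = y) (hcard : 17 ≤ Fintype.card α)
    {t : Equiv.Perm α} (ht : t ∈ G) (htt : t * t = 1) (h6 : t.support.card = 6) :
    alternatingGroup α ≤ G := by
  classical
  by_contra hno
  have hmin : ∀ s ∈ G, s ≠ 1 → 6 ≤ s.support.card := by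
    intro s hs hs1
    by_contra! h
    exact hno (alternatingGroup_le_of_card_support_le_five G h2 hcard hs hs1 (by omega))
  obtain ⟨a, ha⟩ := Finset.card_pos.mp (show 0 < t.support.card by omega)
  set b := t a with hb
  have hba : b ≠ a := mem_support.mp ha
  set K := G ⊓ MulAction.stabilizer (Equiv.Perm α) a with hKdef
  have hK : ∀ g, g ∈ K ↔ g ∈ G ∧ g a = a := fun g => mem_inf_stabilizer_iff G
  set X := t.support.erase a with hX
  set Y := X.erase b with hY
  have hbX : b ∈ X := Finset.mem_erase.mpr ⟨hba, apply_mem_support.mpr ha⟩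
  have hXcard : X.card = 5 := by rw [hX, Finset.card_erase_of_mem ha, h6]
  have hYcard : Y.card = 4 := by rw [hY, Finset.card_erase_of_mem hbX, hXcard]
  have hbY : b ∉ Y := Finset.notMem_erase b X
  have key : ∀ g ∈ K, 1 + (({b} : Finset α).filter fun x => g x ∈ Y).card +
      (Y.filter fun x => g x ∈ ({b} : Finset α)).card +
      (if g b = b then (Y.filter fun x => g x ∈ Y).card else 0) ≤
      (X.filter fun x => g x ∈ X).card := by
    intro g hg
    obtain ⟨hgG, hga⟩ := (hK g).mp hg
    by_cases hgb : g b = b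
    · rw [if_pos hgb]
      have h1 : (({b} : Finset α).filter fun x => g x ∈ Y) = ∅ := by
        simp [Finset.filter_singleton, hgb, hbY]
      have h3 : (Y.filter fun x => g x ∈ ({b} : Finset α)) = ∅ := by
        refine Finset.filter_eq_empty_iff.mpr fun x hx hxb => hbY ?_
        exact g.injective ((Finset.mem_singleton.mp hxb).trans hgb.symm) ▸ hx
      have h4 : b ∉ Y.filter fun x => g x ∈ Y := fun h => hbY (Finset.mem_filter.mp h).1
      rw [h1, h3, Finset.card_empty, add_zero, add_zero, add_comm,
        ← Finset.card_insert_of_notMem h4]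
      refine Finset.card_le_card ?_
      intro x hx
      rcases Finset.mem_insert.mp hx with rfl | hx
      · exact Finset.mem_filter.mpr ⟨hbX, hgb.symm ▸ hbX⟩
      · obtain ⟨hx1, hx2⟩ := Finset.mem_filter.mp hx
        exact Finset.mem_filter.mpr ⟨Finset.mem_of_mem_erase hx1, Finset.mem_of_mem_erase hx2⟩
    · rw [if_neg hgb]
      set u := g * t * g⁻¹ with hu
      have huG : u ∈ G := G.mul_mem (G.mul_mem hgG ht) (G.inv_mem hgG)
      have huu : u * u = 1 := by
        calc u * u = g * (t * t) * g⁻¹ := by rw [hu]; group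
          _ = 1 := by rw [htt]; group
      have hua : u a = g b := by
        have h1 : g⁻¹ a = a := by rw [inv_eq_iff_eq, hga]
        rw [hu, mul_apply, mul_apply, h1]
      have hau : a ∈ u.support := by
        have := (mem_support_conj_iff g t a).mpr ha
        rwa [hga] at this
      have hcomm : 6 ≤ (t * u * t⁻¹ * u⁻¹).support.card ∨ t * u = u * t := by
        by_cases hc : t * u * t⁻¹ * u⁻¹ = 1
        · right
          rw [← mul_inv_eq_one, mul_inv_rev, ← mul_assoc]; exact hc
        · left
          exact hmin _ (G.mul_mem (G.mul_mem (G.mul_mem ht huG) (G.inv_mem ht))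
            (G.inv_mem huG)) hc
      have hle := le_card_support_inter_support htt huu hcomm ha hau
      rw [card_support_inter_support_conj ha hga, hua, ← hb, ← hX, ← hY] at hle
      have h1 : (({b} : Finset α).filter fun x => g x ∈ Y).card = if g b ∈ Y then 1 else 0 := by
        rw [Finset.filter_singleton]; split_ifs <;> rfl
      have h3 : (Y.filter fun x => g x ∈ ({b} : Finset α)).card ≤
          if b ∈ (u.support.erase a).erase (g b) then 1 else 0 := by
        split_ifs with hbu
        · rw [Finset.card_le_one]
          intro x hx y hy
          have h1 := Finset.mem_singleton.mp (Finset.mem_filter.mp hx).2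
          have h2 := Finset.mem_singleton.mp (Finset.mem_filter.mp hy).2
          exact g.injective (h1.trans h2.symm)
        · rw [Nat.le_zero, Finset.card_eq_zero]
          refine Finset.filter_eq_empty_iff.mpr fun x hx hxb => hbu ?_
          rw [Finset.mem_singleton] at hxb
          refine Finset.mem_erase.mpr ⟨Ne.symm hgb, Finset.mem_erase.mpr ⟨hba, ?_⟩⟩
          rw [← hxb]
          exact (mem_support_conj_iff g t x).mpr
            (Finset.mem_of_mem_erase (Finset.mem_of_mem_erase hx))
      omega
  set s := Finset.univ.erase a with hs
  have hsK : ∀ g ∈ K, ∀ x ∈ s, g x ∈ s := fun g hg x hx => by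
    simp only [hs, Finset.mem_erase, Finset.mem_univ, and_true] at hx ⊢
    exact fun h => hx (g.injective (h.trans ((hK g).mp hg).2.symm))
  have hstr : ∀ x ∈ s, ∀ y ∈ s, ∃ g ∈ K, g x = y := fun x hx y hy => by
    obtain ⟨g, hg, hga, hgx⟩ := h2 a x y (Finset.ne_of_mem_erase hx) (Finset.ne_of_mem_erase hy)
    exact ⟨g, (hK g).mpr ⟨hg, hga⟩, hgx⟩
  have hXs : X ⊆ s := Finset.erase_subset_erase a (Finset.subset_univ t.support)
  have hYs : Y ⊆ s := (Finset.erase_subset b X).trans hXs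
  have hbs : ({b} : Finset α) ⊆ s := Finset.singleton_subset_iff.mpr (hXs hbX)
  have hscard : s.card = Fintype.card α - 1 := by
    rw [hs, Finset.card_erase_of_mem (Finset.mem_univ a), Finset.card_univ]
  have sumXX := card_mul_sum_card_filter_apply_mem K s hsK hstr hXs hXs
  have sumbY := card_mul_sum_card_filter_apply_mem K s hsK hstr hbs hYs
  have sumYb := card_mul_sum_card_filter_apply_mem K s hsK hstr hYs hbs
  have sumbb := card_mul_card_filter_apply_eq K s hsK hstr (hXs hbX) (hXs hbX)
  have sumYY := card_sq_mul_card_le_card_mul_sum (K ⊓ MulAction.stabilizer (Equiv.Perm α) b)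
    (s.erase b) (fun g hg x hx => by
      obtain ⟨hgK, hgb⟩ := (mem_inf_stabilizer_iff K).mp hg
      obtain ⟨hxb, hxs⟩ := Finset.mem_erase.mp hx
      exact Finset.mem_erase.mpr ⟨fun h => hxb (g.injective (h.trans hgb.symm)),
        hsK g hgK x hxs⟩) (Finset.erase_subset_erase b hXs)
  simp_rw [mem_inf_stabilizer_iff K] at sumYY
  rw [← hY, Finset.card_erase_of_mem (hXs hbX)] at sumYY
  have sumkey : ∑ g with g ∈ K, (1 + (({b} : Finset α).filter fun x => g x ∈ Y).card +
      (Y.filter fun x => g x ∈ ({b} : Finset α)).card +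
      (if g b = b then (Y.filter fun x => g x ∈ Y).card else 0)) ≤
      ∑ g with g ∈ K, (X.filter fun x => g x ∈ X).card :=
    Finset.sum_le_sum fun g hg => key g (Finset.mem_filter.mp hg).2
  simp_rw [Finset.sum_add_distrib] at sumkey
  rw [← Finset.sum_filter, Finset.filter_filter, ← Finset.card_eq_sum_ones] at sumkey
  rw [hXcard] at sumXX
  rw [hYcard, Finset.card_singleton] at sumbY sumYb
  rw [hYcard] at sumYY
  have hNpos : 0 < (Finset.univ.filter fun g => g ∈ K ∧ g b = b).card :=
    Finset.card_pos.mpr ⟨1, by simp [K.one_mem]⟩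
  generalize (Finset.univ.filter fun g => g ∈ K ∧ g b = b).card = N at *
  generalize (Finset.univ.filter fun g => g ∈ K).card = M at *
  generalize (∑ g with g ∈ K ∧ g b = b, (Y.filter fun x => g x ∈ Y).card) = E at *
  generalize (∑ g with g ∈ K, (X.filter fun x => g x ∈ X).card) = A at *
  generalize (∑ g with g ∈ K, (({b} : Finset α).filter fun x => g x ∈ Y).card) = B at *
  generalize (∑ g with g ∈ K, (Y.filter fun x => g x ∈ ({b} : Finset α)).card) = C at *
  obtain ⟨P, hP⟩ : ∃ P, s.card = P + 16 := ⟨s.card - 16, by omega⟩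
  rw [hP] at sumXX sumbY sumYb sumbb sumYY
  subst sumbb
  have hE : (P + 16) * ((P + 16) * N + E) ≤ (P + 16) * (17 * N) := by nlinarith
  have hE' := Nat.le_of_mul_le_mul_left hE (by omega)
  have h15 : P + 16 - 1 = P + 15 := rfl
  rw [h15] at sumYY
  rcases Nat.eq_zero_or_pos P with rfl | hPpos
  · omega
  · have : E = 0 := by nlinarith
    subst this
    omega

/-- A transitive group of prime degree containing a nontrivial permutation with small support is
doubly transitive. -/
lemma exists_mem_fixing_apply_eq [MulAction.IsPretransitive G α]
    (hp : (Fintype.card α).Prime) (hcard : 13 ≤ Fintype.card α) {t : Equiv.Perm α} (ht : t ∈ G)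
    (ht1 : t ≠ 1) (h6 : t.support.card ≤ 6) (a x y : α) (hx : x ≠ a) (hy : y ≠ a) :
    ∃ g ∈ G, g a = a ∧ g x = y := by
  classical
  obtain ⟨p, hpc⟩ : ∃ p, p = Fintype.card α := ⟨_, rfl⟩
  rw [← hpc] at hp hcard
  have : Fact p.Prime := ⟨hp⟩
  have hdvd : p ∣ Nat.card G := by
    have h1 := MulAction.index_stabilizer_of_transitive G a
    rw [Nat.card_eq_fintype_card, ← hpc] at h1
    exact h1 ▸ Subgroup.index_dvd_card _
  obtain ⟨⟨c, hcG⟩, hc⟩ := exists_prime_orderOf_dvd_card' p hdvd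
  rw [Subgroup.orderOf_mk] at hc
  have hcyc : c.IsCycle := isCycle_of_prime_order'' (hpc ▸ hp) (hc.trans hpc)
  have hcs : ∀ z, c z ≠ z := by
    have : c.support = Finset.univ := by
      rw [← Finset.card_eq_iff_eq_univ, ← hcyc.orderOf, hc, hpc]
    exact fun z => mem_support.mp (this ▸ Finset.mem_univ z)
  have hmod : ∀ n, c ^ (n % p) = c ^ n := fun n => by
    have := pow_mod_orderOf c n
    rwa [hc] at this
  set e₀ : ZMod p → α := fun i => (c ^ i.val) a with he₀
  have hadd : ∀ i j, (c ^ i.val) (e₀ j) = e₀ (i + j) := by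
    intro i j
    rw [he₀]
    simp only [ZMod.val_add, hmod]
    rw [← mul_apply, ← pow_add]
  have hsurj : Function.Surjective e₀ := by
    intro z
    obtain ⟨i, hi⟩ := hcyc.exists_pow_eq (hcs a) (hcs z)
    refine ⟨(i : ZMod p), ?_⟩
    rw [he₀]
    simpa only [ZMod.val_natCast, hmod] using hi
  set e : ZMod p ≃ α := Equiv.ofBijective e₀
    ((Fintype.bijective_iff_surjective_and_card e₀).mpr ⟨hsurj, by rw [ZMod.card, hpc]⟩) with he
  have he0 : e 0 = a := by simp [he, he₀]
  have hshift : ∀ i, ∃ g ∈ G, ∀ j, g (e j) = e (i + j) := fun i =>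
    ⟨c ^ i.val, G.pow_mem hcG _, fun j => hadd i j⟩
  set t' : Equiv.Perm (ZMod p) := (e.trans t).trans e.symm with ht'
  have het' : ∀ i, e (t' i) = t (e i) := fun i => by simp [ht']
  have ht'1 : t' ≠ 1 := by
    intro h
    apply ht1
    ext z
    obtain ⟨i, rfl⟩ := e.surjective z
    rw [← het', h]
    rfl
  have ht's : t'.support.card ≤ 6 := by
    refine le_trans (Finset.card_le_card_of_injOn e (fun i hi => ?_) e.injective.injOn) h6
    simp only [Finset.mem_coe, mem_support] at hi ⊢
    rw [← het']
    exact fun h => hi (e.injective h)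
  let U : ZMod p → Finset (ZMod p) := fun z =>
    Finset.univ.filter fun d => d ≠ 0 ∧ ∃ g ∈ G, g a = a ∧ g (e z) = e d
  have hU : ∀ z d, d ∈ U z ↔ d ≠ 0 ∧ ∃ g ∈ G, g a = a ∧ g (e z) = e d := fun z d => by simp [U]
  have hUcard : ∀ z ≠ 0, p ≤ (U z).card + 6 := by
    intro z hz
    by_contra! hlt
    refine ht'1 (perm_eq_one_of_forall_sub_mem (U z) ⟨z, (hU z z).mpr ⟨hz, 1, G.one_mem, rfl, rfl⟩⟩
      (fun h => ((hU z 0).mp h).1 rfl) t' (by omega) (by omega) fun i u hu => ?_)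
    obtain ⟨hu0, g, hg, hga, hgz⟩ := (hU z u).mp hu
    obtain ⟨s₁, hs₁, hs₁'⟩ := hshift i
    obtain ⟨s₂, hs₂, hs₂'⟩ := hshift (-t' i)
    refine (hU z _).mpr ⟨?_, s₂ * (t * (s₁ * g)),
      G.mul_mem hs₂ (G.mul_mem ht (G.mul_mem hs₁ hg)), ?_, ?_⟩
    · rw [sub_ne_zero]
      exact fun h => hu0 (by simpa using t'.injective h)
    · simp only [mul_apply]
      rw [hga]
      conv_lhs => rw [← he0]
      rw [hs₁', add_zero, ← het', hs₂', neg_add_cancel, he0]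
    · simp only [mul_apply]
      rw [hgz, hs₁', ← het', hs₂', neg_add_eq_sub]
  obtain ⟨i, rfl⟩ := e.surjective x
  obtain ⟨j, rfl⟩ := e.surjective y
  have hi : i ≠ 0 := fun h => hx (by rw [h, he0])
  have hj : j ≠ 0 := fun h => hy (by rw [h, he0])
  by_contra hne
  have hdisj : Disjoint (U i) (U j) := by
    rw [Finset.disjoint_left]
    intro d hdi hdj
    obtain ⟨-, g, hg, hga, hgi⟩ := (hU i d).mp hdi
    obtain ⟨-, k, hk, hka, hkj⟩ := (hU j d).mp hdj
    refine hne ⟨k⁻¹ * g, G.mul_mem (G.inv_mem hk) hg, ?_, ?_⟩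
    · rw [mul_apply, hga, inv_eq_iff_eq, hka]
    · rw [mul_apply, hgi, inv_eq_iff_eq, hkj]
  have hle : (U i ∪ U j).card ≤ p := by
    simpa [ZMod.card] using Finset.card_le_univ (U i ∪ U j)
  rw [Finset.card_union_of_disjoint hdisj] at hle
  have := hUcard i hi
  have := hUcard j hj
  omega

/-- A transitive group of prime degree greater than `13` containing a product of three disjoint
transpositions contains the alternating group. -/
theorem alternatingGroup_le_of_isPretransitive_of_prime_card [MulAction.IsPretransitive G α]
    (hp : (Fintype.card α).Prime) (hcard : 13 < Fintype.card α) {t : Equiv.Perm α} (ht : t ∈ G)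
    (htt : t * t = 1) (h6 : t.support.card = 6) : alternatingGroup α ≤ G := by
  have : MulAction.IsPreprimitive G α :=
    MulAction.IsPreprimitive.of_prime_card (by rwa [Nat.card_eq_fintype_card])
  have ht1 : t ≠ 1 := by rintro rfl; simp at h6
  have h17 : 17 ≤ Fintype.card α := by
    by_contra! h
    interval_cases h : Fintype.card α <;> norm_num at hp
  exact alternatingGroup_le_of_involution G
    (exists_mem_fixing_apply_eq G hp hcard.le ht ht1 h6.le) h17 ht htt h6

lemma eq_alternatingGroup_or_eq_top_s2 (h : alternatingGroup α ≤ G) :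
    G = alternatingGroup α ∨ G = ⊤ := by
  by_cases hG : G ≤ alternatingGroup α
  · exact Or.inl (le_antisymm hG h)
  · right
    obtain ⟨g, hg, hgA⟩ := SetLike.not_le_iff_exists.mp hG
    have hg1 : sign g = -1 := (Int.units_eq_one_or _).resolve_left hgA
    refine (Subgroup.eq_top_iff' G).mpr fun k => ?_
    rcases Int.units_eq_one_or (sign k) with hk | hk
    · exact h hk
    · have : k * g ∈ G := h (by rw [mem_alternatingGroup, map_mul, hk, hg1]; rfl)
      exact (G.mul_mem_cancel_right hg).mp this

end

/-- If an irreducible polynomial over ℚ of prime degree p > 13 has exactly 6 non-real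
complex roots, then its Galois group is A_p or S_p. -/
theorem galois_group_eq_alternating_or_symmetric_of_6_nonreal_roots
    (f : ℚ[X]) (p : ℕ) (hp : p.Prime) (hpgt : 13 < p)
    (hdeg : f.natDegree = p) (hirr : Irreducible f)
    (hroots : {z : ℂ | aeval z f = 0 ∧ z.im ≠ 0}.ncard = 6) :
    Nonempty (f.Gal ≃* alternatingGroup (Fin p)) ∨
      Nonempty (f.Gal ≃* Equiv.Perm (Fin p)) := by
  classical
  have hcard : Fintype.card (f.rootSet ℂ) = p := by
    rw [← hdeg, card_rootSet_eq_natDegree hirr.separable (IsAlgClosed.splits _)]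
  have : Fact ((f.map (algebraMap ℚ ℂ)).Splits) := ⟨IsAlgClosed.splits _⟩
  set φ := Gal.galActionHom f ℂ with hφ
  set c := Gal.restrict f ℂ (AlgEquiv.restrictScalars ℚ Complex.conjAe) with hc
  have hfix : ∀ w : f.rootSet ℂ, φ c w = w ↔ w.val.im = 0 := by
    intro w
    rw [Subtype.ext_iff, hφ, hc, Gal.galActionHom_restrict]
    exact Complex.conj_eq_iff_im
  have hsupp : (φ c).support.card = 6 := by
    rw [← hroots, ← Finset.card_image_of_injective _ Subtype.coe_injective,
      ← Set.ncard_coe_finset]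
    congr 1
    ext z
    simp only [Finset.coe_image, Set.mem_image, Finset.mem_coe, Equiv.Perm.mem_support, ne_eq,
      hfix, Set.mem_ofPred_eq]
    constructor
    · rintro ⟨w, hw, rfl⟩
      exact ⟨(mem_rootSet.mp w.2).2, hw⟩
    · rintro ⟨hz, hzi⟩
      exact ⟨⟨z, mem_rootSet.mpr ⟨hirr.ne_zero, hz⟩⟩, hzi, rfl⟩
  have hinv : φ c * φ c = 1 := by
    rw [hc, ← map_mul, ← map_mul,
      show AlgEquiv.restrictScalars ℚ Complex.conjAe * AlgEquiv.restrictScalars ℚ Complex.conjAe = 1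
        from AlgEquiv.ext Complex.conj_conj, map_one, map_one]
  have htrans : MulAction.IsPretransitive φ.range (f.rootSet ℂ) := by
    have := Gal.galAction_isPretransitive f ℂ hirr
    refine ⟨fun x y => ?_⟩
    obtain ⟨g, hg⟩ := MulAction.exists_smul_eq f.Gal x y
    exact ⟨⟨φ g, g, rfl⟩, hg⟩
  have hle := alternatingGroup_le_of_isPretransitive_of_prime_card φ.range (hcard ▸ hp)
    (hcard ▸ hpgt) ⟨c, rfl⟩ hinv hsupp
  have iso : f.Gal ≃* φ.range := MonoidHom.ofInjective (Gal.galActionHom_injective f ℂ)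
  have e : f.rootSet ℂ ≃ Fin p := Fintype.equivFinOfCardEq hcard
  rcases eq_alternatingGroup_or_eq_top_s2 φ.range hle with h | h
  · exact Or.inl ⟨(iso.trans (MulEquiv.subgroupCongr h)).trans e.altCongrHom⟩
  · exact Or.inr ⟨((iso.trans (MulEquiv.subgroupCongr h)).trans Subgroup.topEquiv).trans
      e.permCongrHom⟩
end
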